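/- arXiv:1003.3723 — 2 statements merged into one kernel-verified Lean document; each statement's English description precedes it below -/
import Mathlib

section
/- Let X denote the set [0,1] equipped with the metric d(x,y) = √|x−y|. There exists a surjective map F : X → [0,1]² that is Lipschitz (from the metric d to the Euclidean metric on [0,1]²), is measure-preserving in the sense that for every Borel set E ⊆ [0,1]² the one-dimensional Lebesgue measure of F⁻¹(E) equals the two-dimensional Lebesgue measure of E, and such that for every subset S ⊆ [0,1] of positive one-dimensional Lebesgue outer measure, F is not biLipschitz on S (with S carrying the metric d). -/
open MeasureTheory Metric Set Filter
open scoped ENNReal NNReal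

noncomputable section

/-- The closed unit square `[0,1]² ⊆ ℝ²` with the Euclidean metric. -/
def unitSquare : Set (EuclideanSpace ℝ (Fin 2)) :=
  {x | ∀ i, x i ∈ Set.Icc (0:ℝ) 1}

/-- `F` is biLipschitz on `S ⊆ [0,1]`, where the domain carries the square-root metric
`d(x,y) = √|x - y|` and the target the Euclidean metric. -/
def BiLipschitzOnSqrt (F : ℝ → EuclideanSpace ℝ (Fin 2)) (S : Set ℝ) : Prop :=
  ∃ L : ℝ, 1 ≤ L ∧ ∀ x ∈ S, ∀ y ∈ S,
    L⁻¹ * Real.sqrt |x - y| ≤ dist (F x) (F y) ∧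
    dist (F x) (F y) ≤ L * Real.sqrt |x - y|

open scoped ComplexConjugate Topology

/-- A Hölder-`1/2` map that identifies the same two interior points of all small dyadic intervals
is not biLipschitz on any set of positive outer measure: around a density point, the set comes
arbitrarily close, relative to the scale, to a pair of identified points. -/
theorem not_biLipschitzOnSqrt_of_identifications {F : ℝ → EuclideanSpace ℝ (Fin 2)} {C : ℝ}
    (hC : 0 ≤ C)
    (hF : ∀ x ∈ Icc (0 : ℝ) 1, ∀ y ∈ Icc (0 : ℝ) 1, dist (F x) (F y) ≤ C * √|x - y|)
    (hid : ∀ n k : ℕ, k < 2 ^ (n + 1) →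
      F ((k + 1 / 4) / 2 ^ (n + 1)) = F ((k + 3 / 4) / 2 ^ (n + 1)))
    {S : Set ℝ} (hS : S ⊆ Icc 0 1) (hpos : 0 < volume S) : ¬ BiLipschitzOnSqrt F S := by
  rintro ⟨L, hL, hbi⟩
  obtain ⟨x, hx, hx01⟩ : ∃ x, (∀ (w δ : ℕ → ℝ), Tendsto δ atTop (𝓝[>] 0) →
      (∀ᶠ j in atTop, x ∈ closedBall (w j) (1 * δ j)) →
      Tendsto (fun j => volume (S ∩ closedBall (w j) (δ j)) / volume (closedBall (w j) (δ j)))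
        atTop (𝓝 1)) ∧ x ∈ Ico (0 : ℝ) 1 := by
    have h1 := IsUnifLocDoublingMeasure.ae_tendsto_measure_inter_div (volume : Measure ℝ) S 1
    have h2 : ∀ᵐ x ∂volume.restrict S, x ∈ Ico (0 : ℝ) 1 := by
      refine ae_restrict_of_ae_restrict_of_subset hS ?_
      rw [← restrict_Ico_eq_restrict_Icc]
      exact ae_restrict_mem measurableSet_Ico
    have : NeBot (ae (volume.restrict S)) := by
      rw [ae_neBot, Ne, Measure.restrict_eq_zero]
      exact hpos.ne'
    obtain ⟨x, hx1, hx2⟩ := (h1.and h2).exists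
    exact ⟨x, fun w δ => hx1 w δ, hx2⟩
  set ε : ℝ := min (1 / 8) ((1 / (8 * L * (C + 1))) ^ 2) with hε
  have hε0 : 0 < ε := by positivity
  have hε8 : ε ≤ 1 / 8 := min_le_left _ _
  have hεL : √ε ≤ 1 / (8 * L * (C + 1)) :=
    Real.sqrt_le_iff.2 ⟨by positivity, min_le_right _ _⟩
  have hlim := hx (fun n => (⌊x * 2 ^ (n + 1)⌋₊ + 1 / 2) / 2 ^ (n + 1))
    (fun n => 1 / 2 / 2 ^ (n + 1)) (by
      refine tendsto_nhdsWithin_iff.2 ⟨?_, .of_forall fun n => by simp only [mem_Ioi]; positivity⟩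
      have := (tendsto_pow_atTop_nhds_zero_of_lt_one (r := (1 / 2 : ℝ)) (by norm_num)
        (by norm_num)).comp (tendsto_add_atTop_nat 1)
      simpa [div_eq_mul_inv] using this.const_mul 2⁻¹) (by
      refine .of_forall fun n => ?_
      have hp : (0 : ℝ) < 2 ^ (n + 1) := by positivity
      have h1 := Nat.floor_le (mul_nonneg hx01.1 hp.le)
      have h2 := Nat.lt_floor_add_one (x * 2 ^ (n + 1))
      rw [Real.closedBall_eq_Icc, one_mul, mem_Icc, ← sub_div, ← add_div, div_le_iff₀ hp,
        le_div_iff₀ hp]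
      constructor <;> linarith)
  obtain ⟨n, hn⟩ := (hlim.eventually_const_lt
    (show ENNReal.ofReal (1 - 2 * ε) < 1 by
      rw [ENNReal.ofReal_lt_one]; linarith)).exists
  set h : ℝ := 1 / 2 ^ (n + 1) with hh
  have hh0 : 0 < h := by positivity
  set k := ⌊x * 2 ^ (n + 1)⌋₊ with hk
  have hk2 : k < 2 ^ (n + 1) := by
    rw [hk, Nat.floor_lt (mul_nonneg hx01.1 (by positivity))]
    push_cast
    have hp : (0 : ℝ) < 2 ^ (n + 1) := by positivity
    nlinarith [hx01.2]
  have hkh : (k + 1) * h ≤ 1 := by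
    rw [hh, mul_one_div, div_le_one (by positivity)]
    exact_mod_cast hk2
  have hk0 : (0 : ℝ) ≤ k * h := by positivity
  have hball : closedBall (((k : ℝ) + 1 / 2) / 2 ^ (n + 1)) (1 / 2 / 2 ^ (n + 1))
      = Icc (k * h) ((k + 1) * h) := by
    rw [Real.closedBall_eq_Icc]
    congr 1 <;> rw [hh] <;> ring
  rw [hball, Real.volume_Icc] at hn
  have key : ∀ c : ℝ, 1 / 4 ≤ c → c ≤ 3 / 4 → ∃ s ∈ S, |s - (k + c) * h| ≤ ε * h := by
    intro c hc1 hc2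
    by_contra! hcon
    have hsub : S ∩ Icc (k * h) ((k + 1) * h) ⊆
        Icc (k * h) ((k + 1) * h) \ Icc ((k + c - ε) * h) ((k + c + ε) * h) := by
      rintro s ⟨hs, hs'⟩
      refine ⟨hs', fun hs'' => (hcon s hs).not_ge ?_⟩
      rw [abs_le]
      constructor <;> linarith [hs''.1, hs''.2]
    have hle := measure_mono (μ := volume) hsub
    rw [measure_sdiff (Icc_subset_Icc (by nlinarith) (by nlinarith))
      measurableSet_Icc.nullMeasurableSet (by simp), Real.volume_Icc, Real.volume_Icc,
      ← ENNReal.ofReal_sub _ (by nlinarith)] at hle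
    refine hn.not_ge ?_
    refine (ENNReal.div_le_div_right hle _).trans ?_
    rw [← ENNReal.ofReal_div_of_pos (by linarith)]
    refine ENNReal.ofReal_le_ofReal ?_
    rw [div_le_iff₀ (by linarith)]
    linarith
  obtain ⟨s, hs, hs'⟩ := key (1 / 4) le_rfl (by norm_num)
  obtain ⟨t, ht, ht'⟩ := key (3 / 4) (by norm_num) le_rfl
  have hFeq : F ((k + 1 / 4) * h) = F ((k + 3 / 4) * h) := by
    simpa only [hh, mul_one_div] using hid n k hk2
  have hbound : ∀ c : ℝ, 1 / 4 ≤ c → c ≤ 3 / 4 → ∀ s ∈ S, |s - (k + c) * h| ≤ ε * h →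
      dist (F s) (F ((k + c) * h)) ≤ C * √(ε * h) := by
    intro c hc1 hc2 s hs hsc
    refine (hF s (hS hs) _ ⟨by positivity, by nlinarith⟩).trans ?_
    gcongr
  have hup : dist (F s) (F t) ≤ 2 * C * (√ε * √h) := by
    have h1 := hbound _ le_rfl (by norm_num) s hs hs'
    have h2 := hbound _ (by norm_num) le_rfl t ht ht'
    rw [← hFeq] at h2
    have h3 := dist_triangle_right (F s) (F t) (F ((k + 1 / 4) * h))
    rw [Real.sqrt_mul hε0.le] at h1 h2
    linarith
  have hlow : 1 / 2 * √h ≤ √|s - t| := by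
    refine Real.le_sqrt_of_sq_le ?_
    rw [mul_pow, Real.sq_sqrt hh0.le, abs_sub_comm]
    refine le_trans ?_ (le_abs_self _)
    rw [abs_le] at hs' ht'
    nlinarith
  have hb := (hbi s hs t ht).1
  have hsh : 0 < √h := Real.sqrt_pos.2 hh0
  have h1 : L⁻¹ * (1 / 2 * √h) ≤ 2 * C * (1 / (8 * L * (C + 1)) * √h) :=
    calc L⁻¹ * (1 / 2 * √h) ≤ L⁻¹ * √|s - t| := by gcongr
      _ ≤ 2 * C * (√ε * √h) := hb.trans hup
      _ ≤ _ := by gcongr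
  have h2 : 2 * C * (1 / (8 * L * (C + 1)) * √h) = L⁻¹ * (C / (C + 1) * (1 / 4 * √h)) := by
    field_simp
    ring
  have h3 : C / (C + 1) ≤ 1 := by rw [div_le_one (by positivity)]; linarith
  rw [h2] at h1
  have h4 := le_of_mul_le_mul_left h1 (by positivity)
  nlinarith [mul_le_mul_of_nonneg_right h3 (by positivity : 0 ≤ 1 / 4 * √h)]

/-- Two probability measures carried by a compact set and invariant under the same balanced pair
of contractions agree. -/
theorem eq_of_self_similar {X : Type*} [MetricSpace X] [MeasurableSpace X] [BorelSpace X]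
    {A B : X → X} {r : ℝ≥0} (hr : r < 1) (hA : LipschitzWith r A) (hB : LipschitzWith r B)
    {K : Set X} (hK : IsCompact K) (hAK : MapsTo A K K) (hBK : MapsTo B K K)
    {μ ν : Measure X} [IsProbabilityMeasure μ] [IsProbabilityMeasure ν]
    (hμK : ∀ᵐ x ∂μ, x ∈ K) (hνK : ∀ᵐ x ∂ν, x ∈ K)
    (hμ : μ = (1 / 2 : ℝ≥0∞) • (μ.map A + μ.map B))
    (hν : ν = (1 / 2 : ℝ≥0∞) • (ν.map A + ν.map B)) : μ = ν := by
  have split : ∀ ρ : Measure X, IsProbabilityMeasure ρ →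
      ρ = (1 / 2 : ℝ≥0∞) • (ρ.map A + ρ.map B) → ∀ g : BoundedContinuousFunction X ℝ,
      ∫ x, g x ∂ρ = 1 / 2 * (∫ x, g (A x) ∂ρ + ∫ x, g (B x) ∂ρ) := by
    intro ρ hρ h g
    have hAm := hA.continuous.measurable.aemeasurable (μ := ρ)
    have hBm := hB.continuous.measurable.aemeasurable (μ := ρ)
    have := Measure.isProbabilityMeasure_map hAm
    have := Measure.isProbabilityMeasure_map hBm
    conv_lhs => rw [h]
    rw [integral_smul_measure, integral_add_measure (g.integrable _) (g.integrable _),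
      integral_map hAm g.continuous.aestronglyMeasurable,
      integral_map hBm g.continuous.aestronglyMeasurable]
    simp
  have key : ∀ (n : ℕ) (ε : ℝ) (g : BoundedContinuousFunction X ℝ),
      (∀ x ∈ K, ∀ y ∈ K, dist x y ≤ r ^ n * diam K → |g x - g y| ≤ ε) →
      |∫ x, g x ∂μ - ∫ x, g x ∂ν| ≤ ε := by
    intro n
    induction n with
    | zero =>
      intro ε g hg
      have hg' : ∀ᵐ y ∂ν, ‖∫ x, g x ∂μ - g y‖ ≤ ε := by
        filter_upwards [hνK] with y hy
        have h1 : ∀ᵐ x ∂μ, ‖g x - g y‖ ≤ ε := by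
          filter_upwards [hμK] with x hx
          exact hg x hx y hy (by simpa using dist_le_diam_of_mem hK.isBounded hx hy)
        simpa [integral_sub (g.integrable μ) (integrable_const _)] using
          norm_integral_le_of_norm_le_const h1
      simpa [integral_sub (integrable_const _) (g.integrable ν)] using
        norm_integral_le_of_norm_le_const hg'
    | succ n ih =>
      intro ε g hg
      have step : ∀ D : X → X, (hD : LipschitzWith r D) → MapsTo D K K →
          |∫ x, g (D x) ∂μ - ∫ x, g (D x) ∂ν| ≤ ε := by
        intro D hD hDK
        refine ih ε (g.compContinuous ⟨D, hD.continuous⟩) fun x hx y hy hxy =>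
          hg _ (hDK hx) _ (hDK hy) ((hD.dist_le_mul x y).trans ?_)
        rw [pow_succ', mul_assoc]
        gcongr
      rw [split μ ‹_› hμ, split ν ‹_› hν]
      have h1 := abs_le.1 (step A hA hAK)
      have h2 := abs_le.1 (step B hB hBK)
      rw [abs_le]
      constructor <;> linarith [h1.1, h1.2, h2.1, h2.2]
  refine ext_of_forall_integral_eq_of_IsFiniteMeasure fun g => ?_
  rw [← sub_eq_zero, ← abs_nonpos_iff]
  refine le_of_forall_pos_le_add fun ε hε => ?_
  obtain ⟨δ, hδ, hgδ⟩ := Metric.uniformContinuousOn_iff.1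
    (hK.uniformContinuousOn_of_continuous g.continuous.continuousOn) ε hε
  have hlim : Tendsto (fun n : ℕ => (r : ℝ) ^ n * diam K) atTop (𝓝 0) := by
    simpa using (tendsto_pow_atTop_nhds_zero_of_lt_one r.2 hr).mul_const (diam K)
  obtain ⟨n, hn⟩ := (hlim.eventually_lt_const hδ).exists
  rw [zero_add]
  exact key n ε g fun x hx y hy hxy => (hgδ x hx y hy (hxy.trans_lt hn)).le

/-- A nonempty closed subset of `T` invariant under a pair of contractions whose images of `T`
cover `T` is all of `T`. -/
theorem subset_of_self_similar {X : Type*} [MetricSpace X] {A B : X → X} {r : ℝ≥0} (hr : r < 1)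
    (hA : LipschitzWith r A) (hB : LipschitzWith r B) {T K : Set X} (hK : IsClosed K)
    (hKT : K ⊆ T) (hne : K.Nonempty) (hAK : MapsTo A K K) (hBK : MapsTo B K K)
    (hT : Bornology.IsBounded T) (hcover : T ⊆ A '' T ∪ B '' T) : T ⊆ K := by
  have key : ∀ (n : ℕ), ∀ x ∈ T, ∃ y ∈ K, dist x y ≤ r ^ n * diam T := by
    intro n
    induction n with
    | zero =>
      intro x hx
      obtain ⟨y, hy⟩ := hne
      exact ⟨y, hy, by simpa using dist_le_diam_of_mem hT hx (hKT hy)⟩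
    | succ n ih =>
      have step : ∀ D : X → X, LipschitzWith r D → MapsTo D K K → ∀ x ∈ T,
          ∃ y ∈ K, dist (D x) y ≤ r ^ (n + 1) * diam T := by
        intro D hD hDK x hx
        obtain ⟨y, hy, hxy⟩ := ih x hx
        refine ⟨D y, hDK hy, (hD.dist_le_mul x y).trans ?_⟩
        rw [pow_succ', mul_assoc]
        gcongr
      intro x hx
      rcases hcover hx with ⟨z, hz, rfl⟩ | ⟨z, hz, rfl⟩
      exacts [step A hA hAK z hz, step B hB hBK z hz]
  intro x hx
  rw [← hK.closure_eq, Metric.mem_closure_iff]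
  intro ε hε
  have hlim : Tendsto (fun n : ℕ => (r : ℝ) ^ n * diam T) atTop (𝓝 0) := by
    simpa using (tendsto_pow_atTop_nhds_zero_of_lt_one r.2 hr).mul_const (diam T)
  obtain ⟨n, hn⟩ := (hlim.eventually_lt_const hε).exists
  obtain ⟨y, hy, hxy⟩ := key n x hx
  exact ⟨y, hy, hxy.trans_lt hn⟩

/-- `F` traverses `A ∘ f` on the first half of `[0,1]` and `B ∘ f` on the second half. -/
structure IsGluing {E : Type*} (A B : E → E) (f F : ℝ → E) : Prop where
  left : ∀ t ∈ Icc (0 : ℝ) 1, F (t / 2) = A (f t)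
  right : ∀ t ∈ Icc (0 : ℝ) 1, F ((1 + t) / 2) = B (f t)

/-- The curve that traverses `A ∘ f` and then `B ∘ f`. -/
def glue {E : Type*} (A B : E → E) (f : ℝ → E) (t : ℝ) : E :=
  if t ≤ 1 / 2 then A (f (2 * t)) else B (f (2 * t - 1))

theorem isGluing_glue {E : Type*} {A B : E → E} {f : ℝ → E} (h : A (f 1) = B (f 0)) :
    IsGluing A B f (glue A B f) where
  left t ht := by
    rw [glue, if_pos (by linarith [ht.2]), mul_div_cancel₀ t two_ne_zero]
  right t ht := by
    rcases ht.1.eq_or_lt with rfl | ht0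
    · rw [glue, if_pos (by norm_num), ← h]
      norm_num
    · rw [glue, if_neg (by linarith), mul_div_cancel₀ _ two_ne_zero, add_sub_cancel_left]

theorem Measurable.glue {E : Type*} [MeasurableSpace E] {A B : E → E} {f : ℝ → E}
    (hA : Measurable A) (hB : Measurable B) (hf : Measurable f) : Measurable (glue A B f) :=
  Measurable.ite measurableSet_Iic (hA.comp (hf.comp (measurable_id.const_mul 2)))
    (hB.comp (hf.comp ((measurable_id.const_mul 2).sub_const 1)))

namespace IsGluing

variable {E : Type*} {A B : E → E} {f F : ℝ → E}

theorem left' (h : IsGluing A B f F) {t : ℝ} (h0 : 0 ≤ t) (h1 : t ≤ 1 / 2) :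
    F t = A (f (2 * t)) := by
  rw [← h.left (2 * t) ⟨by linarith, by linarith⟩, mul_div_cancel_left₀ t two_ne_zero]

theorem right' (h : IsGluing A B f F) {t : ℝ} (h0 : 1 / 2 ≤ t) (h1 : t ≤ 1) :
    F t = B (f (2 * t - 1)) := by
  rw [← h.right (2 * t - 1) ⟨by linarith, by linarith⟩, add_sub_cancel,
    mul_div_cancel_left₀ t two_ne_zero]

theorem image_Icc (h : IsGluing A B f F) :
    F '' Icc 0 1 = A '' (f '' Icc 0 1) ∪ B '' (f '' Icc 0 1) := by
  ext z
  constructor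
  · rintro ⟨t, ht, rfl⟩
    rcases le_total t (1 / 2) with h2 | h2
    · exact .inl ⟨_, ⟨2 * t, ⟨by linarith [ht.1], by linarith⟩, rfl⟩, (h.left' ht.1 h2).symm⟩
    · exact .inr ⟨_, ⟨2 * t - 1, ⟨by linarith, by linarith [ht.2]⟩, rfl⟩,
        (h.right' h2 ht.2).symm⟩
  · rintro (⟨_, ⟨t, ht, rfl⟩, rfl⟩ | ⟨_, ⟨t, ht, rfl⟩, rfl⟩)
    · exact ⟨t / 2, ⟨by linarith [ht.1], by linarith [ht.2]⟩, h.left t ht⟩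
    · exact ⟨(1 + t) / 2, ⟨by linarith [ht.1], by linarith [ht.2]⟩, h.right t ht⟩

theorem map_restrict [MeasurableSpace E] (h : IsGluing A B f F) (hA : Measurable A)
    (hB : Measurable B) (hf : Measurable f) (hF : Measurable F) :
    (volume.restrict (Icc (0 : ℝ) 1)).map F = (1 / 2 : ℝ≥0∞) •
      (((volume.restrict (Icc (0 : ℝ) 1)).map f).map A +
        ((volume.restrict (Icc (0 : ℝ) 1)).map f).map B) := by
  have hhalf : ∀ c : ℝ, (volume.restrict (Icc (0 : ℝ) 1)).map (fun t => (c + t) / 2) =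
      (2 : ℝ≥0∞) • volume.restrict (Icc (c / 2) ((c + 1) / 2)) := by
    intro c
    have hm : Measurable fun t : ℝ => (c + t) / 2 := by fun_prop
    have hpre : (fun t : ℝ => (c + t) / 2) ⁻¹' Icc (c / 2) ((c + 1) / 2) = Icc 0 1 := by
      ext t
      simp only [mem_preimage, mem_Icc]
      constructor <;> rintro ⟨h1, h2⟩ <;> constructor <;> linarith
    have hvol : (volume : Measure ℝ).map (fun t => (c + t) / 2) = (2 : ℝ≥0∞) • volume := by
      have h1 : (fun t : ℝ => (c + t) / 2) = (fun t => t * 2⁻¹) ∘ (c + ·) := rfl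
      rw [h1, ← Measure.map_map (by fun_prop) (by fun_prop), map_add_left_eq_self,
        Real.map_volume_mul_right (by norm_num)]
      simp
    rw [← hpre, ← Measure.restrict_map hm measurableSet_Icc, hvol, Measure.restrict_smul]
  have hsplit : volume.restrict (Icc (0 : ℝ) 1) = (1 / 2 : ℝ≥0∞) •
      ((volume.restrict (Icc (0 : ℝ) 1)).map (fun t => (0 + t) / 2) +
        (volume.restrict (Icc (0 : ℝ) 1)).map (fun t => (1 + t) / 2)) := by
    rw [hhalf, hhalf, ← smul_add, smul_smul, one_div,
      ENNReal.inv_mul_cancel two_ne_zero ENNReal.ofNat_ne_top, one_smul]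
    have hdisj : AEDisjoint volume (Icc ((0 : ℝ) / 2) ((0 + 1) / 2)) (Icc (1 / 2) ((1 + 1) / 2)) := by
      refine measure_mono_null (t := {1 / 2}) ?_ (by simp)
      rintro x ⟨hx, hx'⟩
      exact le_antisymm (by linarith [hx.2]) hx'.1
    rw [← Measure.restrict_union₀ hdisj measurableSet_Icc.nullMeasurableSet]
    congr 1
    norm_num
  have hcomp : ∀ (c : ℝ) (D : E → E), Measurable D →
      (∀ t ∈ Icc (0 : ℝ) 1, F ((c + t) / 2) = D (f t)) →
      ((volume.restrict (Icc (0 : ℝ) 1)).map (fun t => (c + t) / 2)).map F =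
        ((volume.restrict (Icc (0 : ℝ) 1)).map f).map D := by
    intro c D hD hFD
    rw [Measure.map_map hF (by fun_prop), Measure.map_map hD hf]
    exact Measure.map_congr ((ae_restrict_mem measurableSet_Icc).mono hFD)
  conv_lhs => rw [hsplit]
  rw [Measure.map_smul, Measure.map_add _ _ hF,
    hcomp 0 A hA (by simpa using h.left), hcomp 1 B hB h.right]

theorem dist_le [PseudoMetricSpace E] {κ : ℝ≥0} {C : ℝ} (h : IsGluing A B f F)
    (hA : LipschitzWith κ A) (hB : LipschitzWith κ B) (hC : 0 ≤ C)
    (hf : ∀ x ∈ Icc (0 : ℝ) 1, ∀ y ∈ Icc (0 : ℝ) 1, dist (f x) (f y) ≤ C * √|x - y|) :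
    ∀ x ∈ Icc (0 : ℝ) 1, ∀ y ∈ Icc (0 : ℝ) 1,
      dist (F x) (F y) ≤ 4 * κ * C * √|x - y| := by
  have hl : ∀ x y : ℝ, 0 ≤ x → x ≤ y → y ≤ 1 / 2 → dist (F x) (F y) ≤ 2 * κ * C * √|x - y| := by
    intro x y hx hxy hy
    rw [h.left' hx (hxy.trans hy), h.left' (hx.trans hxy) hy]
    refine (hA.dist_le_mul _ _).trans ?_
    have h1 := hf (2 * x) ⟨by linarith, by linarith⟩ (2 * y) ⟨by linarith, by linarith⟩
    have h2 : √|2 * x - 2 * y| ≤ 2 * √|x - y| := by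
      rw [← mul_sub, abs_mul, Real.sqrt_mul (abs_nonneg _)]
      gcongr
      rw [Real.sqrt_le_iff]
      norm_num
    calc κ * dist (f (2 * x)) (f (2 * y)) ≤ κ * (C * (2 * √|x - y|)) := by
          gcongr; exact h1.trans (by gcongr)
      _ = _ := by ring
  have hr : ∀ x y : ℝ, 1 / 2 ≤ x → x ≤ y → y ≤ 1 → dist (F x) (F y) ≤ 2 * κ * C * √|x - y| := by
    intro x y hx hxy hy
    rw [h.right' hx (hxy.trans hy), h.right' (hx.trans hxy) hy]
    refine (hB.dist_le_mul _ _).trans ?_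
    have h1 := hf (2 * x - 1) ⟨by linarith, by linarith⟩ (2 * y - 1) ⟨by linarith, by linarith⟩
    have h2 : √|2 * x - 1 - (2 * y - 1)| ≤ 2 * √|x - y| := by
      rw [sub_sub_sub_cancel_right, ← mul_sub, abs_mul, Real.sqrt_mul (abs_nonneg _)]
      gcongr
      rw [Real.sqrt_le_iff]
      norm_num
    calc κ * dist (f (2 * x - 1)) (f (2 * y - 1)) ≤ κ * (C * (2 * √|x - y|)) := by
          gcongr; exact h1.trans (by gcongr)
      _ = _ := by ring
  have hle : ∀ x y : ℝ, 0 ≤ x → x ≤ y → y ≤ 1 → dist (F x) (F y) ≤ 4 * κ * C * √|x - y| := by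
    intro x y hx hxy hy
    have hpos : 0 ≤ κ * C * √|x - y| := by positivity
    rcases le_total y (1 / 2) with h2 | h2
    · linarith [hl x y hx hxy h2]
    rcases le_total (1 / 2) x with h3 | h3
    · linarith [hr x y h3 hxy hy]
    have h4 : √|x - 1 / 2| ≤ √|x - y| := by
      rw [abs_of_nonpos (by linarith), abs_of_nonpos (by linarith)]
      exact Real.sqrt_le_sqrt (by linarith)
    have h5 : √|1 / 2 - y| ≤ √|x - y| := by
      rw [abs_of_nonpos (by linarith), abs_of_nonpos (by linarith)]
      exact Real.sqrt_le_sqrt (by linarith)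
    calc dist (F x) (F y) ≤ dist (F x) (F (1 / 2)) + dist (F (1 / 2)) (F y) := dist_triangle _ _ _
      _ ≤ 2 * κ * C * √|x - 1 / 2| + 2 * κ * C * √|1 / 2 - y| :=
        add_le_add (hl _ _ hx h3 le_rfl) (hr _ _ le_rfl h2 hy)
      _ ≤ 2 * κ * C * √|x - y| + 2 * κ * C * √|x - y| := by gcongr
      _ = _ := by ring
  intro x hx y hy
  rcases le_total x y with hxy | hxy
  · exact hle x y hx.1 hxy hy.2
  · rw [dist_comm, abs_sub_comm]
    exact hle y x hy.1 hxy hx.2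

/-- An identification made by `f` at one dyadic scale is made by `F` at the next one. -/
theorem identifications (h : IsGluing A B f F) {n : ℕ}
    (hf : ∀ k : ℕ, k < 2 ^ n → f ((k + 1 / 4) / 2 ^ n) = f ((k + 3 / 4) / 2 ^ n)) :
    ∀ k : ℕ, k < 2 ^ (n + 1) →
      F ((k + 1 / 4) / 2 ^ (n + 1)) = F ((k + 3 / 4) / 2 ^ (n + 1)) := by
  have hmem : ∀ (k : ℕ) (c : ℝ), k < 2 ^ n → 0 ≤ c → c ≤ 1 →
      (k + c) / 2 ^ n ∈ Icc (0 : ℝ) 1 := by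
    intro k c hk h0 h1
    have hk' : (k : ℝ) + 1 ≤ 2 ^ n := by exact_mod_cast hk
    exact ⟨by positivity, (div_le_one (by positivity)).2 (by linarith)⟩
  intro k hk
  rcases lt_or_ge k (2 ^ n) with hkn | hkn
  · have h1 : ∀ c : ℝ, ((k : ℝ) + c) / 2 ^ (n + 1) = (k + c) / 2 ^ n / 2 := fun c => by
      rw [pow_succ, div_div]
    rw [h1, h1, h.left _ (hmem k _ hkn (by norm_num) (by norm_num)),
      h.left _ (hmem k _ hkn (by norm_num) (by norm_num)), hf k hkn]
  · obtain ⟨j, rfl⟩ := Nat.exists_eq_add_of_le hkn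
    have hj : j < 2 ^ n := by rw [pow_succ] at hk; omega
    have h1 : ∀ c : ℝ, (((2 ^ n + j : ℕ) : ℝ) + c) / 2 ^ (n + 1) = (1 + (j + c) / 2 ^ n) / 2 :=
      fun c => by
        push_cast
        field_simp
        ring
    rw [h1, h1, h.right _ (hmem j _ hj (by norm_num) (by norm_num)),
      h.right _ (hmem j _ hj (by norm_num) (by norm_num)), hf j hj]

end IsGluing

/-- The self-similar curve attached to two contractions, the second of which starts where the
first one ends. -/
theorem exists_isGluing_self {E : Type*} [MetricSpace E] [CompleteSpace E] [MeasurableSpace E]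
    [BorelSpace E] {A B : E → E} {κ : ℝ≥0} (hκ : κ < 1) (hA : LipschitzWith κ A)
    (hB : LipschitzWith κ B) {a b : E} (ha : A a = a) (hb : B b = b) (hab : A b = B a)
    {T : Set E} (hT : IsClosed T) (hne : T.Nonempty) (hAT : MapsTo A T T) (hBT : MapsTo B T T) :
    ∃ f : ℝ → E, Measurable f ∧ IsGluing A B f f ∧ ∀ t, f t ∈ T := by
  obtain ⟨p, hp⟩ := hne
  set u : ℕ → ℝ → E := fun n => (glue A B)^[n] fun _ => p with hu
  have hsucc : ∀ n, u (n + 1) = glue A B (u n) := fun n => Function.iterate_succ_apply' _ _ _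
  have hmeas : ∀ n, Measurable (u n) := by
    intro n
    induction n with
    | zero => exact measurable_const
    | succ n ih => rw [hsucc]; exact .glue hA.continuous.measurable hB.continuous.measurable ih
  have hmem : ∀ n t, u n t ∈ T := by
    intro n
    induction n with
    | zero => exact fun _ => hp
    | succ n ih =>
      intro t
      rw [hsucc, glue]
      split_ifs
      exacts [hAT (ih _), hBT (ih _)]
  have hdist : ∀ n t, dist (u n t) (u (n + 1) t) ≤ max (dist p (A p)) (dist p (B p)) * κ ^ n := by
    intro n
    induction n with
    | zero =>
      intro t
      rw [hsucc, glue, pow_zero, mul_one]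
      split_ifs
      exacts [le_max_left _ _, le_max_right _ _]
    | succ n ih =>
      intro t
      rw [hsucc, hsucc (n + 1), glue, glue, pow_succ', mul_left_comm]
      split_ifs
      · exact (hA.dist_le_mul _ _).trans (by gcongr; exact ih _)
      · exact (hB.dist_le_mul _ _).trans (by gcongr; exact ih _)
  choose f hf using fun t => cauchySeq_tendsto_of_complete
    (cauchySeq_of_le_geometric (κ : ℝ) _ hκ fun n => hdist n t)
  have hfix : glue A B f = f := by
    funext t
    refine tendsto_nhds_unique ?_ ((hf t).comp (tendsto_add_atTop_nat 1))
    simp only [Function.comp_def, hsucc, glue]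
    split_ifs
    exacts [(hA.continuous.tendsto _).comp (hf _), (hB.continuous.tendsto _).comp (hf _)]
  have hf0 : f 0 = a := by
    refine ContractingWith.fixedPoint_unique' (f := A) ⟨hκ, hA⟩ (?_ : A _ = _) ha
    conv_rhs => rw [← hfix]
    rw [glue, if_pos (by norm_num), mul_zero]
  have hf1 : f 1 = b := by
    refine ContractingWith.fixedPoint_unique' (f := B) ⟨hκ, hB⟩ (?_ : B _ = _) hb
    conv_rhs => rw [← hfix]
    rw [glue, if_neg (by norm_num)]
    norm_num
  refine ⟨f, measurable_of_tendsto_metrizable hmeas (tendsto_pi_nhds.2 hf), ?_,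
    fun t => hT.mem_of_tendsto (hf t) (.of_forall fun n => hmem n t)⟩
  have hglue : IsGluing A B f (glue A B f) := isGluing_glue (by rw [hf0, hf1, hab])
  rwa [hfix] at hglue

/-- A self-similar curve with ratio `1/√2` is Hölder of exponent `1/2`. -/
theorem IsGluing.dist_le_of_self {E : Type*} [PseudoMetricSpace E] {A B : E → E} {f : ℝ → E}
    {κ : ℝ≥0} {D : ℝ} (h : IsGluing A B f f) (hκ : κ * √2 = 1) (hA : LipschitzWith κ A)
    (hB : LipschitzWith κ B) (hD : ∀ x y, dist (f x) (f y) ≤ D) :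
    ∀ x ∈ Icc (0 : ℝ) 1, ∀ y ∈ Icc (0 : ℝ) 1, dist (f x) (f y) ≤ 4 * D * √|x - y| := by
  have hD0 : 0 ≤ D := dist_nonneg.trans (hD 0 0)
  have h2 : 1 < √2 := Real.lt_sqrt_of_sq_lt (by norm_num)
  have hκ1 : (κ : ℝ) < 1 := by
    have := NNReal.coe_nonneg κ
    nlinarith
  have hsqrt : ∀ x : ℝ, κ * √(2 * x) = √x := fun x => by
    rw [Real.sqrt_mul two_pos.le, ← mul_assoc, hκ, one_mul]
  have hhalf : ∀ x : ℝ, 1 / 2 ≤ x → 1 ≤ 2 * √x := fun x hx => by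
    have : 1 / 2 ≤ √x := Real.le_sqrt_of_sq_le (by linarith)
    linarith
  have hlimit : ∀ p q : ℝ, (∀ n : ℕ, p ≤ q + κ ^ n * D) → p ≤ q := by
    intro p q hpq
    refine ge_of_tendsto' (f := fun n : ℕ => q + (κ : ℝ) ^ n * D) (x := atTop) ?_ hpq
    simpa using ((tendsto_pow_atTop_nhds_zero_of_lt_one κ.2 hκ1).mul_const D).const_add q
  have hstep : ∀ (S : E → E), LipschitzWith κ S → ∀ (c x : ℝ) (n : ℕ) (v w : E),
      dist v w ≤ c * √(2 * x) + κ ^ n * D → dist (S v) (S w) ≤ c * √x + κ ^ (n + 1) * D := by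
    intro S hS c x n v w hvw
    calc dist (S v) (S w) ≤ κ * (c * √(2 * x) + κ ^ n * D) := (hS.dist_le_mul _ _).trans (by gcongr)
      _ = c * (κ * √(2 * x)) + κ ^ (n + 1) * D := by ring
      _ = _ := by rw [hsqrt]
  have hstep' : ∀ (S : E → E), LipschitzWith κ S → ∀ (c x : ℝ) (v w : E),
      dist v w ≤ c * √(2 * x) → dist (S v) (S w) ≤ c * √x := by
    intro S hS c x v w hvw
    calc dist (S v) (S w) ≤ κ * (c * √(2 * x)) := (hS.dist_le_mul _ _).trans (by gcongr)
      _ = c * (κ * √(2 * x)) := by ring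
      _ = _ := by rw [hsqrt]
  have hA0 : f 0 = A (f 0) := by simpa using h.left 0 (by simp)
  have hB1 : f 1 = B (f 1) := by simpa using h.right 1 (by simp)
  have near0 : ∀ t ∈ Icc (0 : ℝ) 1, dist (f t) (f 0) ≤ 2 * D * √t := by
    intro t ht
    refine hlimit _ _ fun n => ?_
    induction n generalizing t with
    | zero => linarith [hD t 0, show 0 ≤ 2 * D * √t by positivity]
    | succ n ih =>
      rcases le_total t (1 / 2) with h1 | h1
      · rw [h.left' ht.1 h1, hA0]
        exact hstep A hA _ _ _ _ _ (ih (2 * t) ⟨by linarith [ht.1], by linarith⟩)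
      · have := hD t 0
        nlinarith [hhalf t h1, show 0 ≤ κ ^ (n + 1) * D by positivity]
  have near1 : ∀ t ∈ Icc (0 : ℝ) 1, dist (f t) (f 1) ≤ 2 * D * √(1 - t) := by
    intro t ht
    refine hlimit _ _ fun n => ?_
    induction n generalizing t with
    | zero => linarith [hD t 1, show 0 ≤ 2 * D * √(1 - t) by positivity]
    | succ n ih =>
      rcases le_total (1 / 2) t with h1 | h1
      · rw [h.right' h1 ht.2, hB1]
        refine hstep B hB _ _ _ _ _ ?_
        convert ih (2 * t - 1) ⟨by linarith, by linarith [ht.2]⟩ using 4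
        ring
      · have := hD t 1
        nlinarith [hhalf (1 - t) (by linarith), show 0 ≤ κ ^ (n + 1) * D by positivity]
  have main : ∀ (n : ℕ) (x y : ℝ), 0 ≤ x → x ≤ y → y ≤ 1 →
      dist (f x) (f y) ≤ 4 * D * √(y - x) + κ ^ n * D := by
    intro n
    induction n with
    | zero =>
      intro x y _ _ _
      linarith [hD x y, show 0 ≤ 4 * D * √(y - x) by positivity]
    | succ n ih =>
      intro x y hx hxy hy
      rcases le_total y (1 / 2) with hy2 | hy2
      · rw [h.left' hx (hxy.trans hy2), h.left' (hx.trans hxy) hy2]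
        refine hstep A hA _ _ _ _ _ ?_
        rw [mul_sub]
        exact ih _ _ (by linarith) (by linarith) (by linarith)
      rcases le_total (1 / 2) x with hx2 | hx2
      · rw [h.right' hx2 (hxy.trans hy), h.right' (hx2.trans hxy) hy]
        refine hstep B hB _ _ _ _ _ ?_
        convert ih (2 * x - 1) (2 * y - 1) (by linarith) (by linarith) (by linarith) using 4
        ring
      have e1 : dist (f x) (f (1 / 2)) ≤ 2 * D * √(1 / 2 - x) := by
        rw [h.left' hx hx2, h.left' (t := 1 / 2) (by norm_num) le_rfl]
        refine hstep' A hA _ _ _ _ ?_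
        convert near1 (2 * x) ⟨by linarith, by linarith⟩ using 3 <;> norm_num
        ring
      have e2 : dist (f y) (f (1 / 2)) ≤ 2 * D * √(y - 1 / 2) := by
        rw [h.right' hy2 hy, h.right' (t := 1 / 2) le_rfl (by norm_num)]
        refine hstep' B hB _ _ _ _ ?_
        convert near0 (2 * y - 1) ⟨by linarith, by linarith⟩ using 3 <;> norm_num
        ring
      have e3 : √(1 / 2 - x) ≤ √(y - x) := Real.sqrt_le_sqrt (by linarith)
      have e4 : √(y - 1 / 2) ≤ √(y - x) := Real.sqrt_le_sqrt (by linarith)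
      have e5 := dist_triangle_right (f x) (f y) (f (1 / 2))
      have e6 : 0 ≤ κ ^ (n + 1) * D := by positivity
      nlinarith
  intro x hx y hy
  rcases le_total x y with hxy | hxy
  · rw [abs_sub_comm, abs_of_nonneg (sub_nonneg.2 hxy)]
    exact hlimit _ _ fun n => main n x y hx.1 hxy hy.2
  · rw [dist_comm, abs_of_nonneg (sub_nonneg.2 hxy)]
    exact hlimit _ _ fun n => main n y x hy.1 hxy hx.2

/-- The orientation-reversing similarity `z ↦ b + c z̄` of the plane. -/
def conjSimilarity (b c z : ℂ) : ℂ := b + c * conj z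

theorem dist_conjSimilarity (b c z w : ℂ) :
    dist (conjSimilarity b c z) (conjSimilarity b c w) = ‖c‖ * dist z w := by
  rw [conjSimilarity, conjSimilarity, dist_add_left, dist_eq_norm, ← mul_sub, ← map_sub, norm_mul,
    RCLike.norm_conj, dist_eq_norm]

theorem lipschitzWith_conjSimilarity (b c : ℂ) : LipschitzWith ‖c‖₊ (conjSimilarity b c) :=
  .of_dist_le_mul fun z w => (dist_conjSimilarity b c z w).le

theorem map_conjSimilarity_volume (b : ℂ) {c : ℂ} (hc : c ≠ 0) :
    (volume : Measure ℂ).map (conjSimilarity b c) =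
      ENNReal.ofReal (‖c‖ ^ 2)⁻¹ • volume := by
  have hdet : LinearMap.det (LinearMap.mul ℝ ℂ c) = ‖c‖ ^ 2 := by
    rw [← Complex.normSq_eq_norm_sq, ← Algebra.norm_complex_apply, Algebra.norm_apply]
    rfl
  have hmul : (volume : Measure ℂ).map (c * ·) = ENNReal.ofReal (‖c‖ ^ 2)⁻¹ • volume := by
    have h := Measure.map_linearMap_addHaar_eq_smul_addHaar (volume : Measure ℂ)
      (f := LinearMap.mul ℝ ℂ c) (by rw [hdet]; positivity)
    rw [hdet, abs_of_pos (by positivity)] at h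
    exact h
  have hconj : (volume : Measure ℂ).map conj = volume :=
    Complex.conjLIE.measurePreserving.map_eq
  have hcomp : conjSimilarity b c = (b + ·) ∘ (c * ·) ∘ conj := rfl
  have hconjm : Measurable (conj : ℂ → ℂ) := Complex.continuous_conj.measurable
  rw [hcomp, ← Measure.map_map (by fun_prop) ((measurable_const_mul c).comp hconjm),
    ← Measure.map_map (by fun_prop) hconjm, hconj, hmul, Measure.map_smul, map_add_left_eq_self]

theorem map_conjSimilarity_restrict (b : ℂ) {c : ℂ} (hc : c ≠ 0) {S T : Set ℂ}
    (hS : MeasurableSet S) (h : conjSimilarity b c ⁻¹' S = T) :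
    (volume.restrict T).map (conjSimilarity b c) =
      ENNReal.ofReal (‖c‖ ^ 2)⁻¹ • volume.restrict S := by
  rw [← h, ← Measure.restrict_map (lipschitzWith_conjSimilarity b c).continuous.measurable hS,
    map_conjSimilarity_volume b hc, Measure.restrict_smul]

theorem measurableSet_halfPlane_le (φ : ℂ →ₗ[ℝ] ℝ) (r : ℝ) : MeasurableSet {z | φ z ≤ r} :=
  measurableSet_le φ.continuous_of_finiteDimensional.measurable measurable_const

theorem measurableSet_halfPlane_ge (φ : ℂ →ₗ[ℝ] ℝ) (r : ℝ) : MeasurableSet {z | r ≤ φ z} :=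
  measurableSet_le measurable_const φ.continuous_of_finiteDimensional.measurable

theorem Complex.volume_setOf_linearMap_eq {φ : ℂ →ₗ[ℝ] ℝ} (hφ : φ ≠ 0) (r : ℝ) :
    volume {z | φ z = r} = 0 := by
  rcases {z | φ z = r}.eq_empty_or_nonempty with h | ⟨w, hw⟩
  · rw [h, measure_empty]
  · have : {z | φ z = r} = (fun z => z + -w) ⁻¹' (LinearMap.ker φ : Set ℂ) := by
      ext z
      simp only [mem_ofPred_eq] at hw
      simp [add_neg_eq_zero, hw]
    rw [this, measure_preimage_add_right]
    exact Measure.addHaar_submodule _ _ (by rwa [Ne, LinearMap.ker_eq_top])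

/-- The two closed half-planes bounded by a line cut the Lebesgue measure of any set in two. -/
theorem Complex.restrict_eq_add_of_cut {φ : ℂ →ₗ[ℝ] ℝ} (hφ : φ ≠ 0) (r : ℝ) {T : Set ℂ}
    (hT : MeasurableSet T) :
    volume.restrict T = volume.restrict (T ∩ {z | φ z ≤ r}) +
      volume.restrict (T ∩ {z | r ≤ φ z}) := by
  have hdisj : AEDisjoint volume (T ∩ {z | φ z ≤ r}) (T ∩ {z | r ≤ φ z}) :=
    measure_mono_null (fun z hz => le_antisymm hz.1.2 hz.2.2)
      (Complex.volume_setOf_linearMap_eq hφ r)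
  rw [← Measure.restrict_union₀ hdisj
    (hT.inter (measurableSet_halfPlane_ge φ r)).nullMeasurableSet,
    ← inter_union_distrib_left]
  congr 1
  exact (inter_eq_left.2 fun z _ => le_total (φ z) r).symm

/-- The right isosceles triangle with hypotenuse `[0, 1]` and apex `(1 + i) / 2`. -/
def rightTriangle : Set ℂ := {z | 0 ≤ z.im ∧ z.im ≤ z.re ∧ z.im ≤ 1 - z.re}

theorem isClosed_rightTriangle : IsClosed rightTriangle :=
  (isClosed_le continuous_const Complex.continuous_im).inter
    ((isClosed_le Complex.continuous_im Complex.continuous_re).inter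
      (isClosed_le Complex.continuous_im (continuous_const.sub Complex.continuous_re)))

theorem dist_le_two_of_mem_rightTriangle {z w : ℂ} (hz : z ∈ rightTriangle)
    (hw : w ∈ rightTriangle) : dist z w ≤ 2 := by
  obtain ⟨h1, h2, h3⟩ := hz
  obtain ⟨h4, h5, h6⟩ := hw
  rw [dist_eq_norm]
  refine (Complex.norm_le_abs_re_add_abs_im _).trans ?_
  have h7 : |(z - w).re| ≤ 1 := by rw [Complex.sub_re, abs_le]; constructor <;> linarith
  have h8 : |(z - w).im| ≤ 1 := by rw [Complex.sub_im, abs_le]; constructor <;> linarith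
  linarith

theorem isBounded_rightTriangle : Bornology.IsBounded rightTriangle :=
  Metric.isBounded_iff.2 ⟨2, fun _ hz _ hw => dist_le_two_of_mem_rightTriangle hz hw⟩

/-- The similarity of `rightTriangle` onto its left half. -/
abbrev triangleLeft : ℂ → ℂ := conjSimilarity 0 ((1 + Complex.I) / 2)

/-- The similarity of `rightTriangle` onto its right half. -/
abbrev triangleRight : ℂ → ℂ := conjSimilarity ((1 + Complex.I) / 2) ((1 - Complex.I) / 2)

/-- The similarity of `rightTriangle` onto the lower half of the unit square. -/
abbrev squareLower : ℂ → ℂ := conjSimilarity 0 (1 + Complex.I)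

/-- The similarity of `rightTriangle` onto the upper half of the unit square. -/
abbrev squareUpper : ℂ → ℂ := conjSimilarity (1 + Complex.I) (-(1 + Complex.I))

/-- The closed unit square in the complex plane. -/
def complexSquare : Set ℂ := {z | z.re ∈ Icc (0 : ℝ) 1 ∧ z.im ∈ Icc (0 : ℝ) 1}

theorem isClosed_complexSquare : IsClosed complexSquare :=
  (isClosed_Icc.preimage Complex.continuous_re).inter (isClosed_Icc.preimage Complex.continuous_im)

theorem triangleLeft_re (z : ℂ) : (triangleLeft z).re = (z.re + z.im) / 2 := by
  simp [conjSimilarity]; ring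

theorem triangleLeft_im (z : ℂ) : (triangleLeft z).im = (z.re - z.im) / 2 := by
  simp [conjSimilarity]; ring

theorem triangleRight_re (z : ℂ) : (triangleRight z).re = (1 + z.re - z.im) / 2 := by
  simp [conjSimilarity]; ring

theorem triangleRight_im (z : ℂ) : (triangleRight z).im = (1 - z.re - z.im) / 2 := by
  simp [conjSimilarity]; ring

theorem squareLower_re (z : ℂ) : (squareLower z).re = z.re + z.im := by
  simp [conjSimilarity]

theorem squareLower_im (z : ℂ) : (squareLower z).im = z.re - z.im := by
  simp [conjSimilarity]; ring

theorem squareUpper_re (z : ℂ) : (squareUpper z).re = 1 - z.re - z.im := by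
  simp [conjSimilarity]; ring

theorem squareUpper_im (z : ℂ) : (squareUpper z).im = 1 - z.re + z.im := by
  simp [conjSimilarity]; ring

theorem preimage_triangleLeft :
    triangleLeft ⁻¹' (rightTriangle ∩ {z | Complex.reLm z ≤ 1 / 2}) = rightTriangle := by
  ext z
  simp only [mem_preimage, mem_inter_iff, rightTriangle, mem_ofPred_eq, Complex.reLm_coe,
    triangleLeft_re, triangleLeft_im]
  constructor
  · rintro ⟨⟨h1, h2, h3⟩, h4⟩
    refine ⟨?_, ?_, ?_⟩ <;> linarith
  · rintro ⟨h1, h2, h3⟩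
    refine ⟨⟨?_, ?_, ?_⟩, ?_⟩ <;> linarith

theorem preimage_triangleRight :
    triangleRight ⁻¹' (rightTriangle ∩ {z | 1 / 2 ≤ Complex.reLm z}) = rightTriangle := by
  ext z
  simp only [mem_preimage, mem_inter_iff, rightTriangle, mem_ofPred_eq, Complex.reLm_coe,
    triangleRight_re, triangleRight_im]
  constructor
  · rintro ⟨⟨h1, h2, h3⟩, h4⟩
    refine ⟨?_, ?_, ?_⟩ <;> linarith
  · rintro ⟨h1, h2, h3⟩
    refine ⟨⟨?_, ?_, ?_⟩, ?_⟩ <;> linarith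

theorem preimage_squareLower :
    squareLower ⁻¹' (complexSquare ∩ {z | (Complex.imLm - Complex.reLm) z ≤ 0}) =
      rightTriangle := by
  ext z
  simp only [mem_preimage, mem_inter_iff, rightTriangle, complexSquare, mem_ofPred_eq, mem_Icc,
    LinearMap.sub_apply, Complex.reLm_coe, Complex.imLm_coe, squareLower_re, squareLower_im]
  constructor
  · rintro ⟨⟨⟨h1, h2⟩, h3, h4⟩, h5⟩
    refine ⟨?_, ?_, ?_⟩ <;> linarith
  · rintro ⟨h1, h2, h3⟩
    refine ⟨⟨⟨?_, ?_⟩, ?_, ?_⟩, ?_⟩ <;> linarith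

theorem preimage_squareUpper :
    squareUpper ⁻¹' (complexSquare ∩ {z | 0 ≤ (Complex.imLm - Complex.reLm) z}) =
      rightTriangle := by
  ext z
  simp only [mem_preimage, mem_inter_iff, rightTriangle, complexSquare, mem_ofPred_eq, mem_Icc,
    LinearMap.sub_apply, Complex.reLm_coe, Complex.imLm_coe, squareUpper_re, squareUpper_im]
  constructor
  · rintro ⟨⟨⟨h1, h2⟩, h3, h4⟩, h5⟩
    refine ⟨?_, ?_, ?_⟩ <;> linarith
  · rintro ⟨h1, h2, h3⟩
    refine ⟨⟨⟨?_, ?_⟩, ?_, ?_⟩, ?_⟩ <;> linarith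

theorem surjective_conjSimilarity (b : ℂ) {c : ℂ} (hc : c ≠ 0) :
    Function.Surjective (conjSimilarity b c) := fun z =>
  ⟨conj ((z - b) / c), by
    rw [conjSimilarity, Complex.conj_conj, mul_div_cancel₀ _ hc, add_sub_cancel]⟩

theorem one_add_I_ne_zero : (1 + Complex.I : ℂ) ≠ 0 := fun h => by simpa using congrArg Complex.re h

theorem one_sub_I_ne_zero : (1 - Complex.I : ℂ) ≠ 0 := fun h => by simpa using congrArg Complex.re h

theorem normSq_one_add_I : ‖(1 + Complex.I : ℂ)‖ ^ 2 = 2 := by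
  rw [← Complex.normSq_eq_norm_sq]; simp [Complex.normSq_apply]; norm_num

theorem normSq_one_sub_I : ‖(1 - Complex.I : ℂ)‖ ^ 2 = 2 := by
  rw [← Complex.normSq_eq_norm_sq]; simp [Complex.normSq_apply]; norm_num

theorem reLm_ne_zero : Complex.reLm ≠ 0 := fun h => by simpa using LinearMap.congr_fun h 1

theorem imLm_sub_reLm_ne_zero : Complex.imLm - Complex.reLm ≠ 0 := fun h => by
  simpa using LinearMap.congr_fun h 1

theorem restrict_rightTriangle_self_similar :
    volume.restrict rightTriangle = (1 / 2 : ℝ≥0∞) •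
      ((volume.restrict rightTriangle).map triangleLeft +
        (volume.restrict rightTriangle).map triangleRight) := by
  have hT := isClosed_rightTriangle.measurableSet
  rw [map_conjSimilarity_restrict _ (div_ne_zero one_add_I_ne_zero two_ne_zero)
      (hT.inter (measurableSet_halfPlane_le _ _)) preimage_triangleLeft,
    map_conjSimilarity_restrict _ (div_ne_zero one_sub_I_ne_zero two_ne_zero)
      (hT.inter (measurableSet_halfPlane_ge _ _)) preimage_triangleRight,
    norm_div, norm_div, div_pow, div_pow, normSq_one_add_I, normSq_one_sub_I, ← smul_add,
    ← Complex.restrict_eq_add_of_cut reLm_ne_zero _ hT, smul_smul]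
  have : (1 / 2 : ℝ≥0∞) * ENNReal.ofReal (2 / ‖(2 : ℂ)‖ ^ 2)⁻¹ = 1 := by
    norm_num
    exact ENNReal.inv_mul_cancel two_ne_zero ENNReal.ofNat_ne_top
  rw [this, one_smul]

theorem restrict_complexSquare_eq :
    volume.restrict complexSquare = (2 : ℝ≥0∞) •
      ((volume.restrict rightTriangle).map squareLower +
        (volume.restrict rightTriangle).map squareUpper) := by
  have hQ := isClosed_complexSquare.measurableSet
  rw [map_conjSimilarity_restrict _ one_add_I_ne_zero
      (hQ.inter (measurableSet_halfPlane_le _ _)) preimage_squareLower,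
    map_conjSimilarity_restrict _ (neg_ne_zero.2 one_add_I_ne_zero)
      (hQ.inter (measurableSet_halfPlane_ge _ _)) preimage_squareUpper,
    norm_neg, normSq_one_add_I, ← smul_add,
    ← Complex.restrict_eq_add_of_cut imLm_sub_reLm_ne_zero _ hQ, smul_smul]
  have : (2 : ℝ≥0∞) * ENNReal.ofReal (2 : ℝ)⁻¹ = 1 := by
    rw [ENNReal.ofReal_inv_of_pos two_pos, ENNReal.ofReal_ofNat,
      ENNReal.mul_inv_cancel two_ne_zero ENNReal.ofNat_ne_top]
  rw [this, one_smul]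

theorem volume_complexSquare : volume complexSquare = 1 := by
  have h : complexSquare = Complex.measurableEquivRealProd ⁻¹' (Icc 0 1 ×ˢ Icc 0 1) := rfl
  rw [h, Complex.volume_preserving_equiv_real_prod.measure_preimage_equiv,
    Measure.volume_eq_prod, Measure.prod_prod]
  simp

theorem volume_rightTriangle : 4 * volume rightTriangle = 1 := by
  have h := congrArg (fun μ : Measure ℂ => μ univ) restrict_complexSquare_eq
  have hl := (lipschitzWith_conjSimilarity 0 (1 + Complex.I)).continuous.measurable
  have hu := (lipschitzWith_conjSimilarity (1 + Complex.I) (-(1 + Complex.I))).continuous.measurable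
  simp only [Measure.restrict_apply_univ, volume_complexSquare, Measure.smul_apply,
    Measure.add_apply, Measure.map_apply hl .univ, Measure.map_apply hu .univ, preimage_univ,
    smul_eq_mul] at h
  rw [h]
  ring

theorem mapsTo_triangleLeft : MapsTo triangleLeft rightTriangle rightTriangle := by
  intro z hz
  rw [← preimage_triangleLeft] at hz
  exact hz.1

theorem mapsTo_triangleRight : MapsTo triangleRight rightTriangle rightTriangle := by
  intro z hz
  rw [← preimage_triangleRight] at hz
  exact hz.1

theorem rightTriangle_subset_images :
    rightTriangle ⊆ triangleLeft '' rightTriangle ∪ triangleRight '' rightTriangle := by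
  rw [← preimage_triangleLeft,
    image_preimage_eq _ (surjective_conjSimilarity _ (div_ne_zero one_add_I_ne_zero two_ne_zero)),
    preimage_triangleLeft, ← preimage_triangleRight,
    image_preimage_eq _ (surjective_conjSimilarity _ (div_ne_zero one_sub_I_ne_zero two_ne_zero)),
    preimage_triangleRight, ← inter_union_distrib_left]
  exact fun z hz => ⟨hz, le_total (Complex.reLm z) (1 / 2)⟩

theorem images_rightTriangle_eq_complexSquare :
    squareLower '' rightTriangle ∪ squareUpper '' rightTriangle = complexSquare := by
  rw [← preimage_squareLower, image_preimage_eq _ (surjective_conjSimilarity _ one_add_I_ne_zero),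
    preimage_squareLower, ← preimage_squareUpper,
    image_preimage_eq _ (surjective_conjSimilarity _ (neg_ne_zero.2 one_add_I_ne_zero)),
    ← inter_union_distrib_left]
  exact inter_eq_left.2 fun z _ => le_total ((Complex.imLm - Complex.reLm) z) 0

/-- A self-similar curve filling `rightTriangle`, and doing so with constant speed with respect
to area. -/
theorem exists_triangle_filling_curve :
    ∃ f : ℝ → ℂ, Measurable f ∧ IsGluing triangleLeft triangleRight f f ∧
      f 0 = 0 ∧ f 1 = 1 ∧
      (∀ x ∈ Icc (0 : ℝ) 1, ∀ y ∈ Icc (0 : ℝ) 1, dist (f x) (f y) ≤ 8 * √|x - y|) ∧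
      f '' Icc 0 1 = rightTriangle ∧
      (volume.restrict (Icc (0 : ℝ) 1)).map f = (4 : ℝ≥0∞) • volume.restrict rightTriangle := by
  have h2 : ‖(2 : ℂ)‖ = 2 := by simp
  have hnorm : ‖(1 + Complex.I : ℂ)‖ = √2 := by
    rw [← normSq_one_add_I, Real.sqrt_sq (norm_nonneg _)]
  have hnorm' : ‖(1 - Complex.I : ℂ)‖ = √2 := by
    rw [← normSq_one_sub_I, Real.sqrt_sq (norm_nonneg _)]
  obtain ⟨κ, hκ⟩ : ∃ κ : ℝ≥0, (κ : ℝ) = √2 / 2 := ⟨⟨√2 / 2, by positivity⟩, rfl⟩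
  have hL : LipschitzWith κ triangleLeft := by
    convert lipschitzWith_conjSimilarity 0 ((1 + Complex.I) / 2)
    rw [← NNReal.coe_inj, hκ, coe_nnnorm, norm_div, hnorm, h2]
  have hR : LipschitzWith κ triangleRight := by
    convert lipschitzWith_conjSimilarity ((1 + Complex.I) / 2) ((1 - Complex.I) / 2)
    rw [← NNReal.coe_inj, hκ, coe_nnnorm, norm_div, hnorm', h2]
  have hκ2 : κ * √2 = 1 := by
    rw [hκ, div_mul_eq_mul_div, Real.mul_self_sqrt two_pos.le, div_self two_ne_zero]
  have hκ1 : κ < 1 := by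
    rw [← NNReal.coe_lt_coe, hκ, NNReal.coe_one, div_lt_one two_pos, Real.sqrt_lt' two_pos]
    norm_num
  have hL0 : triangleLeft 0 = 0 := by simp [conjSimilarity]
  have hR1 : triangleRight 1 = 1 := by simp [conjSimilarity]; ring
  have hmid : triangleLeft 1 = triangleRight 0 := by simp [conjSimilarity]
  obtain ⟨f, hfm, hf, hfT⟩ := exists_isGluing_self hκ1 hL hR hL0 hR1 hmid isClosed_rightTriangle
    ⟨0, by simp [rightTriangle]⟩ mapsTo_triangleLeft mapsTo_triangleRight
  have hf0 : f 0 = 0 := ContractingWith.fixedPoint_unique' (f := triangleLeft) ⟨hκ1, hL⟩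
    (by simpa [Function.IsFixedPt] using (hf.left 0 (by simp)).symm) hL0
  have hf1 : f 1 = 1 := ContractingWith.fixedPoint_unique' (f := triangleRight) ⟨hκ1, hR⟩
    (by simpa [Function.IsFixedPt] using (hf.right 1 (by simp)).symm) hR1
  have hHolder : ∀ x ∈ Icc (0 : ℝ) 1, ∀ y ∈ Icc (0 : ℝ) 1, dist (f x) (f y) ≤ 8 * √|x - y| := by
    have := hf.dist_le_of_self hκ2 hL hR (D := 2)
      fun x y => dist_le_two_of_mem_rightTriangle (hfT x) (hfT y)
    intro x hx y hy
    linarith [this x hx y hy]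
  have hcont : ContinuousOn f (Icc 0 1) := by
    intro x hx
    rw [ContinuousWithinAt, tendsto_iff_dist_tendsto_zero]
    refine squeeze_zero' (.of_forall fun _ => dist_nonneg)
      (eventually_mem_nhdsWithin.mono fun y hy => hHolder y hy x hx) ?_
    have : Continuous fun y : ℝ => 8 * √|y - x| := by fun_prop
    simpa using (this.tendsto x).mono_left nhdsWithin_le_nhds
  have himage := hf.image_Icc
  have hsub : f '' Icc 0 1 ⊆ rightTriangle := by
    rintro _ ⟨t, -, rfl⟩
    exact hfT t
  refine ⟨f, hfm, hf, hf0, hf1, hHolder, hsub.antisymm ?_, ?_⟩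
  · refine subset_of_self_similar hκ1 hL hR (isCompact_Icc.image_of_continuousOn hcont).isClosed
      hsub ⟨f 0, 0, by simp, rfl⟩ ?_ ?_ isBounded_rightTriangle rightTriangle_subset_images
    · intro z hz
      rw [himage]
      exact .inl ⟨z, hz, rfl⟩
    · intro z hz
      rw [himage]
      exact .inr ⟨z, hz, rfl⟩
  · have hp : IsProbabilityMeasure (volume.restrict (Icc (0 : ℝ) 1)) := ⟨by simp⟩
    have := Measure.isProbabilityMeasure_map (μ := volume.restrict (Icc (0 : ℝ) 1)) hfm.aemeasurable
    have : IsProbabilityMeasure ((4 : ℝ≥0∞) • volume.restrict rightTriangle) :=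
      ⟨by simp [volume_rightTriangle]⟩
    refine eq_of_self_similar hκ1 hL hR
      (isCompact_of_isClosed_isBounded isClosed_rightTriangle isBounded_rightTriangle)
      mapsTo_triangleLeft mapsTo_triangleRight ?_ ?_
      (hf.map_restrict hL.continuous.measurable hR.continuous.measurable hfm hfm) ?_
    · exact (ae_map_iff hfm.aemeasurable isClosed_rightTriangle.measurableSet).2 (.of_forall hfT)
    · exact Measure.ae_smul_measure (ae_restrict_mem isClosed_rightTriangle.measurableSet) _
    · rw [Measure.map_smul, Measure.map_smul, ← smul_add, smul_comm,
        ← restrict_rightTriangle_self_similar]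

/-- A curve filling the unit square, obtained by gluing two copies of the triangle-filling one. -/
theorem exists_square_filling_curve :
    ∃ F : ℝ → ℂ, Measurable F ∧ F '' Icc 0 1 = complexSquare ∧
      (∃ C : ℝ, 0 ≤ C ∧ ∀ x ∈ Icc (0 : ℝ) 1, ∀ y ∈ Icc (0 : ℝ) 1,
        dist (F x) (F y) ≤ C * √|x - y|) ∧
      (volume.restrict (Icc (0 : ℝ) 1)).map F = volume.restrict complexSquare ∧
      ∀ n k : ℕ, k < 2 ^ (n + 1) →
        F ((k + 1 / 4) / 2 ^ (n + 1)) = F ((k + 3 / 4) / 2 ^ (n + 1)) := by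
  obtain ⟨f, hfm, hf, hf0, hf1, hHolder, himage, hmap⟩ := exists_triangle_filling_curve
  have hl := lipschitzWith_conjSimilarity 0 (1 + Complex.I)
  have hu := lipschitzWith_conjSimilarity (1 + Complex.I) (-(1 + Complex.I))
  rw [nnnorm_neg] at hu
  have hlm := hl.continuous.measurable
  have hum := hu.continuous.measurable
  have hglue : squareLower (f 1) = squareUpper (f 0) := by
    simp [conjSimilarity, hf0, hf1]
  have hF := isGluing_glue hglue
  have hFm := Measurable.glue hlm hum hfm
  refine ⟨_, hFm, ?_, ⟨_, by positivity, hF.dist_le hl hu (by norm_num) hHolder⟩, ?_, ?_⟩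
  · rw [hF.image_Icc, himage, images_rightTriangle_eq_complexSquare]
  · rw [hF.map_restrict hlm hum hfm hFm, hmap, Measure.map_smul, Measure.map_smul, ← smul_add,
      smul_smul, restrict_complexSquare_eq]
    congr 1
    rw [show (4 : ℝ≥0∞) = 2 * 2 by norm_num, ← mul_assoc, one_div,
      ENNReal.inv_mul_cancel two_ne_zero ENNReal.ofNat_ne_top, one_mul]
  · have hid : ∀ n k : ℕ, k < 2 ^ n → f ((k + 1 / 4) / 2 ^ n) = f ((k + 3 / 4) / 2 ^ n) := by
      intro n
      induction n with
      | zero =>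
        intro k hk
        obtain rfl : k = 0 := by simpa using hk
        have hhalf : f (1 / 2) = triangleLeft 1 := by rw [hf.left 1 (by simp), hf1]
        have h1 : f (1 / 4) = f (3 / 4) := by
          rw [hf.left' (t := 1 / 4) (by norm_num) (by norm_num),
            hf.right' (t := 3 / 4) (by norm_num) (by norm_num),
            show (2 : ℝ) * (1 / 4) = 1 / 2 by norm_num,
            show (2 : ℝ) * (3 / 4) - 1 = 1 / 2 by norm_num, hhalf]
          apply Complex.ext
          · rw [triangleLeft_re, triangleRight_re, triangleLeft_re, triangleLeft_im]
            norm_num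
          · rw [triangleLeft_im, triangleRight_im, triangleLeft_re, triangleLeft_im]
            norm_num
        simpa using h1
      | succ n ih => exact hf.identifications ih
    exact fun n => hF.identifications (hid n)

/-- the space-filling curve. With `X = [0,1]` carrying the metric
`d(x,y) = √|x-y|`, there is a surjection `F : X → [0,1]²` that is Lipschitz from `d` to the
Euclidean metric, measure preserving (the 1-dimensional Lebesgue measure of `F⁻¹(E)` equals
the 2-dimensional Lebesgue measure of `E` for every Borel `E ⊆ [0,1]²`), and not
biLipschitz on any `S ⊆ [0,1]` of positive Lebesgue outer measure. -/
theorem statement13 :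
    ∃ F : ℝ → EuclideanSpace ℝ (Fin 2),
      Set.MapsTo F (Set.Icc (0:ℝ) 1) unitSquare ∧
      Set.SurjOn F (Set.Icc (0:ℝ) 1) unitSquare ∧
      (∃ L : ℝ, 0 ≤ L ∧ ∀ x ∈ Set.Icc (0:ℝ) 1, ∀ y ∈ Set.Icc (0:ℝ) 1,
        dist (F x) (F y) ≤ L * Real.sqrt |x - y|) ∧
      (∀ E : Set (EuclideanSpace ℝ (Fin 2)), E ⊆ unitSquare → MeasurableSet E →
        volume (F ⁻¹' E ∩ Set.Icc (0:ℝ) 1) = volume E) ∧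
      ∀ S : Set ℝ, S ⊆ Set.Icc (0:ℝ) 1 → 0 < volume S → ¬ BiLipschitzOnSqrt F S := by
  obtain ⟨F, hFm, himage, ⟨C, hC, hHolder⟩, hmap, hid⟩ := exists_square_filling_curve
  let e := Complex.orthonormalBasisOneI.repr
  have hsquare : ∀ z, e z ∈ unitSquare ↔ z ∈ complexSquare := by
    intro z
    simp [unitSquare, complexSquare, e, Complex.orthonormalBasisOneI_repr_apply]
  have hpre : e ⁻¹' unitSquare = complexSquare := ext hsquare
  have hHolder' : ∀ x ∈ Icc (0 : ℝ) 1, ∀ y ∈ Icc (0 : ℝ) 1,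
      dist (e (F x)) (e (F y)) ≤ C * √|x - y| := fun x hx y hy => by
    rw [e.dist_map]
    exact hHolder x hx y hy
  refine ⟨fun t => e (F t), ?_, ?_, ⟨C, hC, hHolder'⟩, ?_, ?_⟩
  · intro t ht
    rw [hsquare, ← himage]
    exact ⟨t, ht, rfl⟩
  · intro p hp
    obtain ⟨z, rfl⟩ := e.surjective p
    rw [hsquare, ← himage] at hp
    obtain ⟨t, ht, rfl⟩ := hp
    exact ⟨t, ht, rfl⟩
  · intro E hE hEm
    have hEm' : MeasurableSet (e ⁻¹' E) := e.continuous.measurable hEm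
    have hsub : e ⁻¹' E ⊆ complexSquare := hpre ▸ preimage_mono hE
    calc volume ((fun t => e (F t)) ⁻¹' E ∩ Icc 0 1)
        = (volume.restrict (Icc (0 : ℝ) 1)).map F (e ⁻¹' E) := by
          rw [Measure.map_apply hFm hEm', Measure.restrict_apply (hFm hEm')]
          rfl
      _ = volume (e ⁻¹' E) := by
          rw [hmap, Measure.restrict_apply hEm', inter_eq_left.2 hsub]
      _ = volume E := e.measurePreserving.measure_preimage hEm.nullMeasurableSet
  · intro S hS hpos
    exact not_biLipschitzOnSqrt_of_identifications hC hHolder'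
      (fun n k hk => congrArg e (hid n k hk)) hS hpos
end
end

section
/- Let X denote the set [0,1] equipped with the metric d(x,y) = √|x−y|. There exists a surjective Lipschitz map F : X → [0,1]² (from the metric d to the Euclidean metric) with the following property: for every countable collection {A_i}_{i∈ℕ} of subsets of [0,1] such that F is biLipschitz on each A_i (with A_i carrying the metric d), the set F([0,1] \ ⋃_i A_i) has two-dimensional Lebesgue measure equal to 1. In particular, no countable collection of sets on which F is biLipschitz can cover [0,1] up to a set whose image under F is null. -/
open MeasureTheory Metric Set Filter
open scoped ENNReal NNReal

noncomputable section

/-- The four similarities of ratio `1/2` generating the Hilbert curve. -/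
def hilbertSim (i : Fin 4) (p : EuclideanSpace ℝ (Fin 2)) : EuclideanSpace ℝ (Fin 2) :=
  ![!₂[p 1 / 2, p 0 / 2], !₂[p 0 / 2, p 1 / 2 + 1 / 2], !₂[p 0 / 2 + 1 / 2, p 1 / 2 + 1 / 2],
    !₂[1 - p 1 / 2, 1 / 2 - p 0 / 2]] i

theorem dist_hilbertSim (i : Fin 4) (p q : EuclideanSpace ℝ (Fin 2)) :
    dist (hilbertSim i p) (hilbertSim i q) = dist p q / 2 := by
  have h4 : √(4 : ℝ) = 2 := by
    rw [show (4 : ℝ) = 2 ^ 2 by norm_num]; exact Real.sqrt_sq (by norm_num)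
  have key : dist p q / 2 = √(((p 0 - q 0) ^ 2 + (p 1 - q 1) ^ 2) / 4) := by
    rw [EuclideanSpace.dist_eq, Real.sqrt_div' _ (by norm_num), h4, Fin.sum_univ_two,
      Real.dist_eq, Real.dist_eq, sq_abs, sq_abs]
  rw [key, EuclideanSpace.dist_eq, Fin.sum_univ_two, Real.dist_eq, Real.dist_eq, sq_abs, sq_abs]
  congr 1
  fin_cases i <;> simp [hilbertSim] <;> ring

theorem continuous_hilbertSim (i : Fin 4) : Continuous (hilbertSim i) := by
  refine LipschitzWith.continuous (K := 1) (LipschitzWith.of_dist_le_mul fun p q => ?_)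
  rw [dist_hilbertSim]
  simp only [NNReal.coe_one, one_mul]
  linarith [dist_nonneg (x := p) (y := q)]

theorem mem_unitSquare_iff {p : EuclideanSpace ℝ (Fin 2)} :
    p ∈ unitSquare ↔ (0 ≤ p 0 ∧ p 0 ≤ 1) ∧ 0 ≤ p 1 ∧ p 1 ≤ 1 := by
  simp [unitSquare, Fin.forall_fin_two]

theorem hilbertSim_mem_unitSquare (i : Fin 4) {p : EuclideanSpace ℝ (Fin 2)}
    (hp : p ∈ unitSquare) : hilbertSim i p ∈ unitSquare := by
  rw [mem_unitSquare_iff] at hp ⊢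
  obtain ⟨⟨h1, h2⟩, h3, h4⟩ := hp
  fin_cases i <;> simp [hilbertSim] <;> refine ⟨⟨?_, ?_⟩, ?_, ?_⟩ <;> linarith

theorem exists_hilbertSim_eq {p : EuclideanSpace ℝ (Fin 2)} (hp : p ∈ unitSquare) :
    ∃ i, ∃ q ∈ unitSquare, p = hilbertSim i q := by
  have h := mem_unitSquare_iff.1 hp
  obtain ⟨⟨h1, h2⟩, h3, h4⟩ := h
  rcases le_total (p 0) (1 / 2) with hx | hx <;> rcases le_total (p 1) (1 / 2) with hy | hy
  · refine ⟨0, !₂[2 * p 1, 2 * p 0], mem_unitSquare_iff.2 ?_, ?_⟩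
    · simp; refine ⟨⟨?_, ?_⟩, ?_, ?_⟩ <;> linarith
    · ext i; fin_cases i <;> simp [hilbertSim]
  · refine ⟨1, !₂[2 * p 0, 2 * p 1 - 1], mem_unitSquare_iff.2 ?_, ?_⟩
    · simp; refine ⟨⟨?_, ?_⟩, ?_, ?_⟩ <;> linarith
    · ext i; fin_cases i <;> simp [hilbertSim]; ring
  · refine ⟨3, !₂[1 - 2 * p 1, 2 - 2 * p 0], mem_unitSquare_iff.2 ?_, ?_⟩
    · simp; refine ⟨⟨?_, ?_⟩, ?_, ?_⟩ <;> linarith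
    · ext i; fin_cases i <;> simp [hilbertSim] <;> ring
  · refine ⟨2, !₂[2 * p 0 - 1, 2 * p 1 - 1], mem_unitSquare_iff.2 ?_, ?_⟩
    · simp; refine ⟨⟨?_, ?_⟩, ?_, ?_⟩ <;> linarith
    · ext i; fin_cases i <;> simp [hilbertSim] <;> ring

theorem isClosed_unitSquare : IsClosed unitSquare := by
  simp only [unitSquare, ofPred_forall]
  exact isClosed_iInter fun i => isClosed_Icc.preimage (by fun_prop)

theorem dist_le_two_of_mem_unitSquare {p q : EuclideanSpace ℝ (Fin 2)} (hp : p ∈ unitSquare)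
    (hq : q ∈ unitSquare) : dist p q ≤ 2 := by
  rw [mem_unitSquare_iff] at hp hq
  rw [EuclideanSpace.dist_eq, Fin.sum_univ_two, Real.dist_eq, Real.dist_eq, sq_abs, sq_abs]
  apply Real.sqrt_le_iff.2 ⟨by norm_num, ?_⟩
  nlinarith

theorem volume_unitSquare : volume unitSquare = 1 := by
  have h : unitSquare = (WithLp.ofLp : EuclideanSpace ℝ (Fin 2) → Fin 2 → ℝ) ⁻¹'
      (Set.univ.pi fun _ => Icc (0 : ℝ) 1) := by
    ext p; simp only [unitSquare, mem_preimage, mem_univ_pi]; rfl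
  rw [h, (PiLp.volume_preserving_ofLp (Fin 2)).measure_preimage
    (MeasurableSet.univ_pi fun _ => measurableSet_Icc).nullMeasurableSet, volume_pi_pi]
  simp

theorem exists_quarter {x : ℝ} (hx : x ∈ Icc (0 : ℝ) 1) :
    ∃ i : Fin 4, ∃ t ∈ Icc (0 : ℝ) 1, x = ((i : ℕ) + t) / 4 := by
  obtain ⟨h0, h1⟩ := hx
  rcases le_total x (1 / 4) with h | h
  · exact ⟨0, 4 * x, ⟨by linarith, by linarith⟩, by simp⟩
  rcases le_total x (1 / 2) with h' | h'
  · exact ⟨1, 4 * x - 1, ⟨by linarith, by linarith⟩, by simp⟩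
  rcases le_total x (3 / 4) with h'' | h''
  · exact ⟨2, 4 * x - 2, ⟨by linarith, by linarith⟩, by simp⟩
  · exact ⟨3, 4 * x - 3, ⟨by linarith, by linarith⟩, by simp⟩

theorem quarter_mem_Icc (i : Fin 4) {t : ℝ} (ht : t ∈ Icc (0 : ℝ) 1) :
    ((i : ℕ) + t) / 4 ∈ Icc (0 : ℝ) 1 := by
  obtain ⟨h0, h1⟩ := ht
  have h3 : ((i : ℕ) : ℝ) ≤ 3 := by exact_mod_cast Nat.le_of_lt_succ i.2
  constructor
  · positivity
  · linarith

/-- The polygonal approximations of the Hilbert curve. -/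
def hilbertApprox : ℕ → ℝ → EuclideanSpace ℝ (Fin 2)
  | 0, t => !₂[t, 0]
  | n + 1, t =>
    if t ≤ 1 / 4 then hilbertSim 0 (hilbertApprox n (4 * t))
    else if t ≤ 1 / 2 then hilbertSim 1 (hilbertApprox n (4 * t - 1))
    else if t ≤ 3 / 4 then hilbertSim 2 (hilbertApprox n (4 * t - 2))
    else hilbertSim 3 (hilbertApprox n (4 * t - 3))

theorem hilbertApprox_zero_one (n : ℕ) :
    hilbertApprox n 0 = !₂[0, 0] ∧ hilbertApprox n 1 = !₂[1, 0] := by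
  induction n with
  | zero => simp [hilbertApprox]
  | succ n ih =>
    obtain ⟨h0, h1⟩ := ih
    constructor
    · simp [hilbertApprox, h0, hilbertSim]
    · rw [hilbertApprox]
      norm_num [h1, hilbertSim]
      rfl

theorem hilbertApprox_quarter (n : ℕ) (i : Fin 4) {t : ℝ} (ht : t ∈ Icc (0 : ℝ) 1) :
    hilbertApprox (n + 1) (((i : ℕ) + t) / 4) = hilbertSim i (hilbertApprox n t) := by
  obtain ⟨h0, h1⟩ := hilbertApprox_zero_one n
  obtain ⟨ht0, ht1⟩ := ht
  rcases ht0.eq_or_lt with rfl | htpos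
  · fin_cases i <;> rw [hilbertApprox] <;> norm_num [h0, h1, hilbertSim]
    rfl
  · fin_cases i
    · rw [hilbertApprox, if_pos (by simp; linarith)]
      congr 2; simp; ring
    · rw [hilbertApprox, if_neg (by simp; linarith), if_pos (by simp; linarith)]
      congr 2; simp; ring
    · rw [hilbertApprox, if_neg (by simp; linarith), if_neg (by simp; linarith),
        if_pos (by simp; linarith)]
      congr 2; simp; ring
    · rw [hilbertApprox, if_neg (by simp; linarith), if_neg (by simp; linarith),
        if_neg (by simp; linarith)]
      congr 2; simp; ring

theorem hilbertApprox_mem (n : ℕ) {t : ℝ} (ht : t ∈ Icc (0 : ℝ) 1) :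
    hilbertApprox n t ∈ unitSquare := by
  induction n generalizing t with
  | zero => simpa [hilbertApprox, mem_unitSquare_iff] using ht
  | succ n ih =>
    obtain ⟨i, s, hs, rfl⟩ := exists_quarter ht
    rw [hilbertApprox_quarter n i hs]
    exact hilbertSim_mem_unitSquare i (ih hs)

theorem dist_hilbertApprox_succ (n : ℕ) {t : ℝ} (ht : t ∈ Icc (0 : ℝ) 1) :
    dist (hilbertApprox n t) (hilbertApprox (n + 1) t) ≤ 4 / 2 / 2 ^ n := by
  induction n generalizing t with
  | zero =>
    have := dist_le_two_of_mem_unitSquare (hilbertApprox_mem 0 ht) (hilbertApprox_mem 1 ht)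
    norm_num at this ⊢
    exact this
  | succ n ih =>
    obtain ⟨i, s, hs, rfl⟩ := exists_quarter ht
    rw [hilbertApprox_quarter n i hs, hilbertApprox_quarter (n + 1) i hs, dist_hilbertSim]
    rw [pow_succ, ← div_div]
    gcongr
    exact ih hs

/-- The Hilbert curve (only meaningful on `[0,1]`). -/
def hilbertCurve (t : ℝ) : EuclideanSpace ℝ (Fin 2) :=
  limUnder atTop fun n => hilbertApprox n t

theorem tendsto_hilbertApprox {t : ℝ} (ht : t ∈ Icc (0 : ℝ) 1) :
    Tendsto (fun n => hilbertApprox n t) atTop (nhds (hilbertCurve t)) :=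
  (cauchySeq_of_le_geometric_two fun n => dist_hilbertApprox_succ n ht).tendsto_limUnder

theorem hilbertCurve_mem {t : ℝ} (ht : t ∈ Icc (0 : ℝ) 1) : hilbertCurve t ∈ unitSquare :=
  isClosed_unitSquare.mem_of_tendsto (tendsto_hilbertApprox ht)
    (Eventually.of_forall fun n => hilbertApprox_mem n ht)

theorem hilbertCurve_quarter (i : Fin 4) {t : ℝ} (ht : t ∈ Icc (0 : ℝ) 1) :
    hilbertCurve (((i : ℕ) + t) / 4) = hilbertSim i (hilbertCurve t) := by
  refine tendsto_nhds_unique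
    ((tendsto_hilbertApprox (quarter_mem_Icc i ht)).comp (tendsto_add_atTop_nat 1)) ?_
  refine (((continuous_hilbertSim i).tendsto _).comp (tendsto_hilbertApprox ht)).congr fun n => ?_
  exact (hilbertApprox_quarter n i ht).symm

theorem dist_hilbertCurve_quarter (i : Fin 4) {s t : ℝ} (hs : s ∈ Icc (0 : ℝ) 1)
    (ht : t ∈ Icc (0 : ℝ) 1) :
    dist (hilbertCurve (((i : ℕ) + s) / 4)) (hilbertCurve (((i : ℕ) + t) / 4)) =
      dist (hilbertCurve s) (hilbertCurve t) / 2 := by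
  rw [hilbertCurve_quarter i hs, hilbertCurve_quarter i ht, dist_hilbertSim]

theorem sqrt_div_four (x : ℝ) : √(x / 4) = √x / 2 := by
  rw [Real.sqrt_div' _ (by norm_num), show (4 : ℝ) = 2 ^ 2 by norm_num,
    Real.sqrt_sq (by norm_num)]

theorem half_le_sqrt {x : ℝ} (hx : 1 / 4 ≤ x) : 1 / 2 ≤ √x :=
  Real.le_sqrt_of_sq_le (by linarith)

theorem dist_hilbertCurve_zero {t : ℝ} (ht : t ∈ Icc (0 : ℝ) 1) :
    dist (hilbertCurve 0) (hilbertCurve t) ≤ 4 * √t := by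
  have z : (0 : ℝ) ∈ Icc (0 : ℝ) 1 := by simp
  have coarse : ∀ {t : ℝ}, t ∈ Icc (0 : ℝ) 1 → 1 / 4 ≤ t →
      dist (hilbertCurve 0) (hilbertCurve t) ≤ 4 * √t := fun ht h => by
    linarith [dist_le_two_of_mem_unitSquare (hilbertCurve_mem z) (hilbertCurve_mem ht),
      half_le_sqrt h]
  rcases ht.1.eq_or_lt with rfl | hpos
  · simp
  obtain ⟨n, hn⟩ := exists_pow_lt_of_lt_one hpos (show (1 / 4 : ℝ) < 1 by norm_num)
  clear hpos
  induction n generalizing t with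
  | zero => exact coarse ht (by norm_num at hn; linarith)
  | succ n ih =>
    obtain ⟨i, s, hs, rfl⟩ := exists_quarter ht
    rcases Nat.eq_zero_or_pos (i : ℕ) with hi | hi
    · have e := dist_hilbertCurve_quarter i z hs
      simp only [hi, Nat.cast_zero, zero_add, zero_div] at e hn ⊢
      rw [pow_succ] at hn
      rw [e, sqrt_div_four]
      linarith [ih hs (by linarith)]
    · have : (1 : ℝ) ≤ (i : ℕ) := by exact_mod_cast hi
      exact coarse ht (by linarith [hs.1])

theorem dist_hilbertCurve_one {t : ℝ} (ht : t ∈ Icc (0 : ℝ) 1) :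
    dist (hilbertCurve t) (hilbertCurve 1) ≤ 4 * √(1 - t) := by
  have z : (1 : ℝ) ∈ Icc (0 : ℝ) 1 := by simp
  have coarse : ∀ {t : ℝ}, t ∈ Icc (0 : ℝ) 1 → 1 / 4 ≤ 1 - t →
      dist (hilbertCurve t) (hilbertCurve 1) ≤ 4 * √(1 - t) := fun ht h => by
    linarith [dist_le_two_of_mem_unitSquare (hilbertCurve_mem ht) (hilbertCurve_mem z),
      half_le_sqrt h]
  rcases ht.2.eq_or_lt with rfl | hlt
  · simp
  obtain ⟨n, hn⟩ := exists_pow_lt_of_lt_one (sub_pos.2 hlt) (show (1 / 4 : ℝ) < 1 by norm_num)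
  clear hlt
  induction n generalizing t with
  | zero => exact coarse ht (by norm_num at hn; linarith [ht.1])
  | succ n ih =>
    obtain ⟨i, s, hs, rfl⟩ := exists_quarter ht
    rcases (Nat.le_of_lt_succ i.2).eq_or_lt with hi | hi
    · have e := dist_hilbertCurve_quarter i hs z
      rw [hi] at e hn ⊢
      rw [show (((3 : ℕ) : ℝ) + 1) / 4 = 1 by norm_num] at e
      rw [pow_succ] at hn
      push_cast at e hn ⊢
      rw [e, show 1 - (3 + s) / 4 = (1 - s) / 4 by ring, sqrt_div_four]
      linarith [ih hs (by linarith)]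
    · have : ((i : ℕ) : ℝ) ≤ 2 := by exact_mod_cast Nat.le_of_lt_succ hi
      exact coarse ht (by linarith [hs.2])

theorem dist_hilbertCurve_le_of_lt {s t : ℝ} (hs : s ∈ Icc (0 : ℝ) 1) (ht : t ∈ Icc (0 : ℝ) 1)
    (hst : s < t) : dist (hilbertCurve s) (hilbertCurve t) ≤ 8 * √(t - s) := by
  have coarse : ∀ {s t : ℝ}, s ∈ Icc (0 : ℝ) 1 → t ∈ Icc (0 : ℝ) 1 → 1 / 4 ≤ t - s →
      dist (hilbertCurve s) (hilbertCurve t) ≤ 8 * √(t - s) := fun hs ht h => by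
    linarith [dist_le_two_of_mem_unitSquare (hilbertCurve_mem hs) (hilbertCurve_mem ht),
      half_le_sqrt h]
  obtain ⟨n, hn⟩ := exists_pow_lt_of_lt_one (sub_pos.2 hst) (show (1 / 4 : ℝ) < 1 by norm_num)
  clear hst
  induction n generalizing s t with
  | zero => exact coarse hs ht (by norm_num at hn; linarith)
  | succ n ih =>
    obtain ⟨i, s, hs', rfl⟩ := exists_quarter hs
    obtain ⟨j, t, ht', rfl⟩ := exists_quarter ht
    have hpos : (0 : ℝ) < (1 / 4) ^ (n + 1) := by positivity
    rcases lt_trichotomy (i : ℕ) (j : ℕ) with hij | hij | hij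
    · rcases (Nat.succ_le_of_lt hij).eq_or_lt with h | h
      · have hj : ((j : ℕ) : ℝ) = (i : ℕ) + 1 := by exact_mod_cast h.symm
        have e₁ := dist_hilbertCurve_quarter i hs' (show (1 : ℝ) ∈ Icc (0 : ℝ) 1 by simp)
        have e₂ := dist_hilbertCurve_quarter j (show (0 : ℝ) ∈ Icc (0 : ℝ) 1 by simp) ht'
        rw [hj, add_zero] at e₂
        rw [hj]
        have b₁ : √(1 - s) ≤ √(1 - s + t) := Real.sqrt_le_sqrt (by linarith [ht'.1])
        have b₂ : √t ≤ √(1 - s + t) := Real.sqrt_le_sqrt (by linarith [hs'.2])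
        rw [show ((i : ℕ) + 1 + t) / 4 - ((i : ℕ) + s) / 4 = (1 - s + t) / 4 by ring,
          sqrt_div_four]
        have := dist_triangle (hilbertCurve (((i : ℕ) + s) / 4))
          (hilbertCurve (((i : ℕ) + 1) / 4)) (hilbertCurve (((i : ℕ) + 1 + t) / 4))
        linarith [dist_hilbertCurve_zero ht', dist_hilbertCurve_one hs']
      · have hj : ((i : ℕ) : ℝ) + 2 ≤ (j : ℕ) := by exact_mod_cast h
        exact coarse hs ht (by linarith [hs'.2, ht'.1])
    · obtain rfl := Fin.ext hij
      rw [show ((i : ℕ) + t) / 4 - ((i : ℕ) + s) / 4 = (t - s) / 4 by ring] at hn ⊢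
      rw [dist_hilbertCurve_quarter i hs' ht', sqrt_div_four]
      rw [pow_succ] at hn
      linarith [ih hs' ht' (by linarith)]
    · have hj : ((j : ℕ) : ℝ) + 1 ≤ (i : ℕ) := by exact_mod_cast hij
      linarith [hs'.1, ht'.2]

theorem dist_hilbertCurve_le {s t : ℝ} (hs : s ∈ Icc (0 : ℝ) 1) (ht : t ∈ Icc (0 : ℝ) 1) :
    dist (hilbertCurve s) (hilbertCurve t) ≤ 8 * √|s - t| := by
  rcases lt_trichotomy s t with h | rfl | h
  · rw [abs_sub_comm, abs_of_pos (sub_pos.2 h)]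
    exact dist_hilbertCurve_le_of_lt hs ht h
  · simp
  · rw [dist_comm, abs_of_pos (sub_pos.2 h)]
    exact dist_hilbertCurve_le_of_lt ht hs h

theorem holderOnWith_hilbertCurve : HolderOnWith 8 (1 / 2) hilbertCurve (Icc (0 : ℝ) 1) := by
  intro s hs t ht
  have := dist_hilbertCurve_le hs ht
  rw [Real.sqrt_eq_rpow, ← Real.dist_eq] at this
  rw [edist_dist, edist_dist, ENNReal.ofReal_rpow_of_nonneg dist_nonneg (by positivity),
    ← ENNReal.ofReal_coe_nnreal, ← ENNReal.ofReal_mul (by positivity)]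
  exact ENNReal.ofReal_le_ofReal (by exact_mod_cast this)

theorem surjOn_hilbertCurve : SurjOn hilbertCurve (Icc (0 : ℝ) 1) unitSquare := by
  have approx : ∀ n : ℕ, ∀ p ∈ unitSquare, ∃ t ∈ Icc (0 : ℝ) 1,
      dist (hilbertCurve t) p ≤ 2 * (1 / 2) ^ n := by
    intro n
    induction n with
    | zero =>
      intro p hp
      have z : (0 : ℝ) ∈ Icc (0 : ℝ) 1 := by simp
      exact ⟨0, z, by simpa using dist_le_two_of_mem_unitSquare (hilbertCurve_mem z) hp⟩
    | succ n ih =>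
      intro p hp
      obtain ⟨i, q, hq, rfl⟩ := exists_hilbertSim_eq hp
      obtain ⟨t, ht, h⟩ := ih q hq
      refine ⟨_, quarter_mem_Icc i ht, ?_⟩
      rw [hilbertCurve_quarter i ht, dist_hilbertSim, pow_succ]
      linarith
  intro p hp
  have hc : IsClosed (hilbertCurve '' Icc (0 : ℝ) 1) :=
    (isCompact_Icc.image_of_continuousOn
      (holderOnWith_hilbertCurve.continuousOn (by norm_num))).isClosed
  rw [← hc.closure_eq, Metric.mem_closure_iff]
  intro ε hε
  obtain ⟨n, hn⟩ := exists_pow_lt_of_lt_one (half_pos hε) (show (1 / 2 : ℝ) < 1 by norm_num)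
  obtain ⟨t, ht, h⟩ := approx n p hp
  exact ⟨_, mem_image_of_mem _ ht, by rw [dist_comm]; linarith⟩

theorem exists_hilbertCurve_eq :
    ∃ a ∈ Icc (0 : ℝ) (1 / 4), ∃ b ∈ Icc (3 / 4 : ℝ) 1, hilbertCurve a = hilbertCurve b := by
  obtain ⟨s, hs, hs'⟩ := surjOn_hilbertCurve
    (show !₂[0, 1] ∈ unitSquare by simp [mem_unitSquare_iff])
  obtain ⟨t, ht, ht'⟩ := surjOn_hilbertCurve
    (show !₂[1, 1] ∈ unitSquare by simp [mem_unitSquare_iff])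
  refine ⟨(((0 : Fin 4) : ℕ) + s) / 4, ?_, (((3 : Fin 4) : ℕ) + t) / 4, ?_, ?_⟩
  · constructor <;> simp <;> linarith [hs.1, hs.2]
  · constructor <;> simp <;> linarith [ht.1, ht.2]
  · rw [hilbertCurve_quarter 0 hs, hilbertCurve_quarter 3 ht, hs', ht']
    norm_num [hilbertSim]
    rfl

theorem exists_zoom (n : ℕ) {x : ℝ} (hx : x ∈ Icc (0 : ℝ) 1) :
    ∃ c : ℝ, x ∈ Icc c (c + (1 / 4) ^ n) ∧ ∀ s ∈ Icc (0 : ℝ) 1, ∀ t ∈ Icc (0 : ℝ) 1,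
      c + (1 / 4) ^ n * s ∈ Icc (0 : ℝ) 1 ∧
      dist (hilbertCurve (c + (1 / 4) ^ n * s)) (hilbertCurve (c + (1 / 4) ^ n * t)) =
        (1 / 2) ^ n * dist (hilbertCurve s) (hilbertCurve t) := by
  induction n generalizing x with
  | zero => exact ⟨0, by simpa using hx, fun s hs t ht => by simpa using hs⟩
  | succ n ih =>
    obtain ⟨i, y, hy, rfl⟩ := exists_quarter hx
    obtain ⟨c, ⟨h1, h2⟩, h⟩ := ih hy
    have e : ∀ s : ℝ, ((i : ℕ) + c) / 4 + (1 / 4) ^ (n + 1) * s =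
        ((i : ℕ) + (c + (1 / 4) ^ n * s)) / 4 := fun s => by rw [pow_succ]; ring
    refine ⟨((i : ℕ) + c) / 4, ⟨by linarith, ?_⟩, fun s hs t ht => ?_⟩
    · have := e 1
      rw [mul_one, mul_one] at this
      rw [this]
      linarith
    · rw [e, e, dist_hilbertCurve_quarter i (h s hs t ht).1 (h t ht s hs).1, (h s hs t ht).2,
        pow_succ]
      exact ⟨quarter_mem_Icc i (h s hs t ht).1, by ring⟩

theorem exists_hole {A : Set ℝ} {L : ℝ} (hL : 1 ≤ L)
    (hA : ∀ x ∈ A, ∀ y ∈ A, L⁻¹ * √|x - y| ≤ dist (hilbertCurve x) (hilbertCurve y))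
    {c : ℝ} {n : ℕ}
    (hc : ∀ s ∈ Icc (0 : ℝ) 1, ∀ t ∈ Icc (0 : ℝ) 1,
      dist (hilbertCurve (c + (1 / 4) ^ n * s)) (hilbertCurve (c + (1 / 4) ^ n * t)) =
        (1 / 2) ^ n * dist (hilbertCurve s) (hilbertCurve t)) :
    ∃ u : ℝ, 0 ≤ u ∧ u + (1 / (32 * L)) ^ 2 ≤ 1 ∧
      ∀ s ∈ Icc u (u + (1 / (32 * L)) ^ 2), c + (1 / 4) ^ n * s ∉ A := by
  obtain ⟨a, ha, b, hb, hab⟩ := exists_hilbertCurve_eq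
  set ε : ℝ := (1 / (32 * L)) ^ 2 with hε
  have hL0 : 0 < L := by linarith
  have hsqrt : √ε = 1 / (32 * L) := Real.sqrt_sq (by positivity)
  have hε0 : 0 < ε := by positivity
  have hε1 : ε ≤ 1 / 1024 := by
    have : 1 / (32 * L) ≤ 1 / 32 := by gcongr; linarith
    calc ε ≤ (1 / 32) ^ 2 := by rw [hε]; gcongr
      _ = _ := by norm_num
  by_contra! hcon
  obtain ⟨s, hs, hsA⟩ := hcon a ha.1 (by linarith [ha.2])
  obtain ⟨t, ht, htA⟩ := hcon (b - ε) (by linarith [hb.1]) (by linarith [hb.2])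
  have hs1 : s ∈ Icc (0 : ℝ) 1 := ⟨by linarith [ha.1, hs.1], by linarith [ha.2, hs.2]⟩
  have ht1 : t ∈ Icc (0 : ℝ) 1 := ⟨by linarith [hb.1, ht.1], by linarith [hb.2, ht.2]⟩
  have h1 := hA _ hsA _ htA
  rw [hc s hs1 t ht1, show c + (1 / 4) ^ n * s - (c + (1 / 4) ^ n * t) =
    ((1 / 2) ^ n) ^ 2 * (s - t) by rw [← pow_mul, mul_comm n 2, pow_mul]; norm_num; ring,
    abs_mul, abs_of_nonneg (by positivity), Real.sqrt_mul (by positivity),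
    Real.sqrt_sq (by positivity), mul_left_comm] at h1
  have h2 : L⁻¹ * √|s - t| ≤ dist (hilbertCurve s) (hilbertCurve t) :=
    le_of_mul_le_mul_left h1 (by positivity)
  have d1 : dist (hilbertCurve s) (hilbertCurve a) ≤ 8 * √ε := by
    refine (dist_hilbertCurve_le hs1 ⟨ha.1, by linarith [ha.2]⟩).trans ?_
    gcongr
    rw [abs_le]; constructor <;> linarith [hs.1, hs.2]
  have d2 : dist (hilbertCurve a) (hilbertCurve t) ≤ 8 * √ε := by
    rw [hab]
    refine (dist_hilbertCurve_le ⟨by linarith [hb.1], hb.2⟩ ht1).trans ?_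
    gcongr
    rw [abs_le]; constructor <;> linarith [ht.1, ht.2]
  have h3 : 1 / 2 < √|s - t| := by
    apply Real.lt_sqrt_of_sq_lt
    rw [abs_sub_comm]
    exact lt_of_lt_of_le (by linarith [hs.2, ht.1, ha.2, hb.1]) (le_abs_self _)
  have h4 : L⁻¹ * (1 / 2) < L⁻¹ * √|s - t| := by gcongr
  have h5 : 16 * (1 / (32 * L)) = L⁻¹ * (1 / 2) := by field_simp; norm_num
  linarith [dist_triangle (hilbertCurve s) (hilbertCurve a) (hilbertCurve t)]

theorem volume_eq_zero_of_biLipschitzOnSqrt {A : Set ℝ} (hA : A ⊆ Icc (0 : ℝ) 1)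
    (hF : BiLipschitzOnSqrt hilbertCurve A) : volume A = 0 := by
  obtain ⟨L, hL, hF⟩ := hF
  set ε : ℝ := (1 / (32 * L)) ^ 2 with hε
  have hL0 : 0 < L := by linarith
  have hε0 : 0 < ε := by positivity
  rw [measure_eq_zero_iff_ae_notMem]
  filter_upwards [ae_imp_of_ae_restrict
    (IsUnifLocDoublingMeasure.ae_tendsto_measure_inter_div volume A 1)] with x hx hxA
  choose c hxc hc using fun n : ℕ => exists_zoom n (hA hxA)
  have hball : ∀ n, closedBall (c n + (1 / 4) ^ n / 2) ((1 / 4) ^ n / 2) =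
      Icc (c n) (c n + (1 / 4) ^ n) := fun n => by
    rw [Real.closedBall_eq_Icc]; congr 1 <;> ring
  have hlim : Tendsto (fun n : ℕ => (1 / 4 : ℝ) ^ n / 2) atTop (nhdsWithin 0 (Ioi 0)) := by
    refine tendsto_nhdsWithin_iff.2 ⟨?_, Eventually.of_forall fun n => ?_⟩
    · simpa using (tendsto_pow_atTop_nhds_zero_of_lt_one (show (0 : ℝ) ≤ 1 / 4 by norm_num)
        (by norm_num)).div_const 2
    · exact mem_Ioi.2 (by positivity)
  have := hx hxA (fun n : ℕ => c n + (1 / 4) ^ n / 2) (fun n : ℕ => (1 / 4 : ℝ) ^ n / 2) hlim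
    (Eventually.of_forall fun n => by rw [one_mul, hball]; exact hxc n)
  have hle : (1 : ℝ≥0∞) ≤ ENNReal.ofReal (1 - ε) := by
    refine le_of_tendsto' this fun n => ?_
    obtain ⟨u, hu0, hu1, hu⟩ := exists_hole hL (fun x hx y hy => (hF x hx y hy).1)
      fun s hs t ht => (hc n s hs t ht).2
    rw [← hε] at hu1 hu
    have hr : (0 : ℝ) < (1 / 4) ^ n := by positivity
    have hsub : A ∩ Icc (c n) (c n + (1 / 4) ^ n) ⊆ Icc (c n) (c n + (1 / 4) ^ n) \
        Icc (c n + (1 / 4) ^ n * u) (c n + (1 / 4) ^ n * (u + ε)) := by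
      rintro y ⟨hyA, hy⟩
      refine ⟨hy, fun hyu => hu ((y - c n) / (1 / 4) ^ n) ⟨?_, ?_⟩ ?_⟩
      · rw [le_div_iff₀ hr]; linarith [hyu.1]
      · rw [div_le_iff₀ hr]; linarith [hyu.2]
      · rwa [mul_div_cancel₀ _ hr.ne', add_sub_cancel]
    have hIcc : Icc (c n + (1 / 4) ^ n * u) (c n + (1 / 4) ^ n * (u + ε)) ⊆
        Icc (c n) (c n + (1 / 4) ^ n) :=
      Icc_subset_Icc (by linarith [mul_nonneg hr.le hu0])
        (by linarith [mul_le_mul_of_nonneg_left hu1 hr.le])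
    rw [hball n, Real.volume_Icc, add_sub_cancel_left]
    refine ENNReal.div_le_of_le_mul ((measure_mono hsub).trans ?_)
    rw [measure_sdiff hIcc measurableSet_Icc.nullMeasurableSet (by simp), Real.volume_Icc,
      Real.volume_Icc, ← ENNReal.ofReal_sub _ (by nlinarith),
      ← ENNReal.ofReal_mul (by linarith)]
    exact ENNReal.ofReal_le_ofReal (by ring_nf; rfl)
  rw [← ENNReal.ofReal_one, ENNReal.ofReal_le_ofReal_iff'] at hle
  rcases hle with h | h <;> linarith

theorem volume_hilbertCurve_image_eq_zero {A : Set ℝ} (hA : A ⊆ Icc (0 : ℝ) 1)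
    (h0 : volume A = 0) : volume (hilbertCurve '' A) = 0 := by
  have h := (holderOnWith_hilbertCurve.mono hA).hausdorffMeasure_image_le (by norm_num)
    (show (0 : ℝ) ≤ 2 by norm_num)
  rw [show ((1 / 2 : ℝ≥0) : ℝ) * 2 = 1 by norm_num, hausdorffMeasure_real, h0, mul_zero,
    nonpos_iff_eq_zero] at h
  rw [← EuclideanSpace.euclideanHausdorffMeasure_eq_volume,
    Measure.euclideanHausdorffMeasure_def]
  simp [h]

/-- With `X = [0,1]` carrying the metric `d(x,y) = √|x-y|`, there is a
surjective Lipschitz map `F : X → [0,1]²` such that for every countable collection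
`{A_i}` of subsets of `[0,1]` with `F` biLipschitz on each `A_i`, the set
`F([0,1] \ ⋃ i, A_i)` has two-dimensional Lebesgue measure `1`. -/
theorem statement14 :
    ∃ F : ℝ → EuclideanSpace ℝ (Fin 2),
      Set.MapsTo F (Set.Icc (0:ℝ) 1) unitSquare ∧
      Set.SurjOn F (Set.Icc (0:ℝ) 1) unitSquare ∧
      (∃ L : ℝ, 0 ≤ L ∧ ∀ x ∈ Set.Icc (0:ℝ) 1, ∀ y ∈ Set.Icc (0:ℝ) 1,
        dist (F x) (F y) ≤ L * Real.sqrt |x - y|) ∧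
      ∀ A : ℕ → Set ℝ, (∀ i, A i ⊆ Set.Icc (0:ℝ) 1) →
        (∀ i, BiLipschitzOnSqrt F (A i)) →
        volume (F '' (Set.Icc (0:ℝ) 1 \ ⋃ i, A i)) = 1 := by
  refine ⟨hilbertCurve, fun t ht => hilbertCurve_mem ht, surjOn_hilbertCurve,
    ⟨8, by norm_num, fun s hs t ht => dist_hilbertCurve_le hs ht⟩, fun A hA hF => ?_⟩
  have h0 : volume (hilbertCurve '' ⋃ i, A i) = 0 :=
    volume_hilbertCurve_image_eq_zero (iUnion_subset hA)
      (measure_iUnion_null fun i => volume_eq_zero_of_biLipschitzOnSqrt (hA i) (hF i))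
  refine le_antisymm ?_ ?_
  · rw [← volume_unitSquare]
    exact measure_mono (image_subset_iff.2 fun t ht => hilbertCurve_mem ht.1)
  · rw [← volume_unitSquare, ← measure_sdiff_null (s := unitSquare) h0]
    refine measure_mono fun p hp => ?_
    obtain ⟨t, ht, rfl⟩ := surjOn_hilbertCurve hp.1
    exact ⟨t, ⟨ht, fun h => hp.2 (mem_image_of_mem _ h)⟩, rfl⟩
end
end
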